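/- arXiv:2406.02493 — 4 statements merged into one kernel-verified Lean document; each statement's English description precedes it below -/
import Mathlib

section
/- Let α = (α_1,…,α_t) be palindromic (α_i = α_{t+1−i} for all i) with t odd, and let F = F̆(α) with elements x_1,…,x_n where n = #F. Then the statistics χ_{x_k} − χ_{x_{n−k+1}} are 0-mesic under rowmotion for all k ∈ {1,…,n} if and only if the statistics χ̂_{x_k} + χ̂_{x_{n−k+1}} are 1-mesic under rowmotion for all k ∈ {1,…,n}. -/
open scoped Classical

namespace Fence

/-- partial sums: `m α i = α 0 + ⋯ + α (i-1)` (the paper's `m_i`). -/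
def m (α : ℕ → ℕ) (i : ℕ) : ℕ := ∑ k ∈ Finset.range i, α k

/-- the number `n` of elements of the fence `F̆(α)`. -/
def nn (t : ℕ) (α : ℕ → ℕ) : ℕ := m α t - 1

/-- vertex type: index `0` is a dummy (used as sentinel for nonexistent elements);
the fence elements are the indices `1,…,nn t α`. -/
abbrev V (t : ℕ) (α : ℕ → ℕ) := Fin (nn t α + 1)

/-- the element `x_j` (1-based). -/
def xel (t : ℕ) (α : ℕ → ℕ) (j : ℕ) : V t α :=
  ⟨j % (nn t α + 1), Nat.mod_lt _ (Nat.succ_pos _)⟩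

/-- `p` is an actual element of the fence (not the dummy `0`). -/
def Elem (t : ℕ) (α : ℕ → ℕ) (p : V t α) : Prop := 1 ≤ (p : ℕ)

/-- the conditions on `(t, α)` for `F̆(α)` to be a fence. -/
def IsFence (t : ℕ) (α : ℕ → ℕ) : Prop :=
  2 ≤ t ∧ (∀ i < t, 1 ≤ α i) ∧ 2 ≤ α 0 ∧ 2 ≤ α (t - 1)

/-- the covering relation of the fence: `Cov t α a b` means `a ⋖ b`. -/
def Cov (t : ℕ) (α : ℕ → ℕ) (a b : V t α) : Prop :=
  ∃ i < t, ((i % 2 = 0 ∧ (b : ℕ) = (a : ℕ) + 1) ∨ (i % 2 = 1 ∧ (a : ℕ) = (b : ℕ) + 1)) ∧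
    m α i ≤ min (a : ℕ) (b : ℕ) ∧ min (a : ℕ) (b : ℕ) < m α (i + 1) ∧
    1 ≤ min (a : ℕ) (b : ℕ) ∧ max (a : ℕ) (b : ℕ) ≤ nn t α

/-- the order of the fence: reflexive–transitive closure of the covering relation. -/
def Le (t : ℕ) (α : ℕ → ℕ) : V t α → V t α → Prop := Relation.ReflTransGen (Cov t α)

/-- order ideals of the fence (as sets of actual elements, downward closed). -/
def IsIdeal (t : ℕ) (α : ℕ → ℕ) (I : Set (V t α)) : Prop :=
  (∀ p ∈ I, Elem t α p) ∧ ∀ a b : V t α, Le t α a b → b ∈ I → a ∈ I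

/-- `J t α` is the set of order ideals of the fence. -/
abbrev J (t : ℕ) (α : ℕ → ℕ) := {I : Set (V t α) // IsIdeal t α I}

/-- `p` is a maximal element of the set `I`. -/
def MaxIn (t : ℕ) (α : ℕ → ℕ) (I : Set (V t α)) (p : V t α) : Prop :=
  p ∈ I ∧ ∀ q ∈ I, Le t α p q → q = p

/-- `p` is a minimal element of the complement of `I` (among actual elements). -/
def MinOut (t : ℕ) (α : ℕ → ℕ) (I : Set (V t α)) (p : V t α) : Prop :=
  Elem t α p ∧ p ∉ I ∧ ∀ q : V t α, Elem t α q → q ∉ I → Le t α q p → q = p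

/-- the order-ideal indicator function `χ̂_p`. -/
noncomputable def chiHat (t : ℕ) (α : ℕ → ℕ) (p : V t α) (I : J t α) : ℝ :=
  if p ∈ I.1 then 1 else 0

/-- the antichain indicator function `χ_p`. -/
noncomputable def chi (t : ℕ) (α : ℕ → ℕ) (p : V t α) (I : J t α) : ℝ :=
  if MaxIn t α I.1 p then 1 else 0

/-- the toggleability statistic `T_p`. -/
noncomputable def Tg (t : ℕ) (α : ℕ → ℕ) (p : V t α) (I : J t α) : ℝ :=
  if MinOut t α I.1 p then 1 else if MaxIn t α I.1 p then -1 else 0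

/-- the antichain toggleability statistic `T_A`. -/
noncomputable def TA (t : ℕ) (α : ℕ → ℕ) (A : Set (V t α)) (I : J t α) : ℝ :=
  if ∀ p ∈ A, MinOut t α I.1 p then 1 else if ∀ p ∈ A, MaxIn t α I.1 p then -1 else 0

/-- `#[a,b]`: the number of elements `r` with `a ⊴ r ⊴ b`. -/
noncomputable def icard (t : ℕ) (α : ℕ → ℕ) (a b : V t α) : ℕ :=
  Set.ncard {r : V t α | Elem t α r ∧ Le t α a r ∧ Le t α r b}

/-- the span of the toggleability statistics `{T_p : p ∈ F}`. -/
noncomputable def ToggSpan (t : ℕ) (α : ℕ → ℕ) : Submodule ℝ (J t α → ℝ) :=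
  Submodule.span ℝ {f | ∃ p : V t α, Elem t α p ∧ f = Tg t α p}

/-- `f ≡ g`: `f - g` is an `ℝ`-linear combination of toggleability statistics. -/
def Equiv' (t : ℕ) (α : ℕ → ℕ) (f g : J t α → ℝ) : Prop := f - g ∈ ToggSpan t α

/-- statistics of the form `const + linear combination of toggleability statistics`. -/
noncomputable def ConstPlusTogg (t : ℕ) (α : ℕ → ℕ) : Submodule ℝ (J t α → ℝ) :=
  ToggSpan t α ⊔ Submodule.span ℝ {fun _ : J t α => (1 : ℝ)}

/-- the span of the antichain indicator functions `{χ_p : p ∈ F}`. -/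
noncomputable def chiSpan (t : ℕ) (α : ℕ → ℕ) : Submodule ℝ (J t α → ℝ) :=
  Submodule.span ℝ {f | ∃ p : V t α, Elem t α p ∧ f = chi t α p}

/-- the span of the order-ideal indicator functions `{χ̂_p : p ∈ F}`. -/
noncomputable def chiHatSpan (t : ℕ) (α : ℕ → ℕ) : Submodule ℝ (J t α → ℝ) :=
  Submodule.span ℝ {f | ∃ p : V t α, Elem t α p ∧ f = chiHat t α p}

/-- the antichain toggleability space `A_T(F)`. -/
noncomputable def AT (t : ℕ) (α : ℕ → ℕ) : Submodule ℝ (J t α → ℝ) :=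
  chiSpan t α ⊓ ConstPlusTogg t α

/-- the order ideal toggleability space `I_T(F)`. -/
noncomputable def IT (t : ℕ) (α : ℕ → ℕ) : Submodule ℝ (J t α → ℝ) :=
  chiHatSpan t α ⊓ ConstPlusTogg t α

/-- the shared element `s_i = x_{m_i}` (for `1 ≤ i ≤ t-1`); the sentinels `i = 0` and
`i = t` give the dummy vertex `0`, so statistics indexed by them vanish. -/
def sElx (t : ℕ) (α : ℕ → ℕ) (i : ℕ) : V t α := xel t α (m α i)

/-- 1-based index of the unshared element `s_{(i,j)}` (the `j`-th smallest unshared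
element of the segment `S_i`, in the order of the fence). -/
def uEl (α : ℕ → ℕ) (i j : ℕ) : ℕ :=
  if (i - 1) % 2 = 0 then m α (i - 1) + j else m α i - j

def uElx (t : ℕ) (α : ℕ → ℕ) (i j : ℕ) : V t α := xel t α (uEl α i j)

/-- 1-based index of the peak of segment `S_i` (sentinel `0` if it does not exist). -/
def peakN (t : ℕ) (α : ℕ → ℕ) (i : ℕ) : ℕ :=
  if i % 2 = 1 then (if i + 1 ≤ t then m α i else 0) else m α (i - 1)

/-- 1-based index of the valley of segment `S_i` (sentinel `0` if it does not exist). -/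
def valleyN (t : ℕ) (α : ℕ → ℕ) (i : ℕ) : ℕ :=
  if i % 2 = 1 then (if 2 ≤ i then m α (i - 1) else 0) else (if i + 1 ≤ t then m α i else 0)

def peakx (t : ℕ) (α : ℕ → ℕ) (i : ℕ) : V t α := xel t α (peakN t α i)
def valleyx (t : ℕ) (α : ℕ → ℕ) (i : ℕ) : V t α := xel t α (valleyN t α i)

/-- segment `S_i` has a peak. -/
def HasPeak (t i : ℕ) : Prop := i % 2 = 0 ∨ i + 1 ≤ t

/-- segment `S_i` has a valley. -/
def HasValley (t i : ℕ) : Prop := (i % 2 = 1 ∧ 2 ≤ i) ∨ (i % 2 = 0 ∧ i + 1 ≤ t)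

/-- `p` is a shared element of the fence. -/
def IsSharedElem (t : ℕ) (α : ℕ → ℕ) (p : V t α) : Prop :=
  ∃ i, 1 ≤ i ∧ i + 1 ≤ t ∧ p = sElx t α i

/-- `p` is a peak of the fence. -/
def IsPeakElem (t : ℕ) (α : ℕ → ℕ) (p : V t α) : Prop :=
  ∃ i, 1 ≤ i ∧ i + 1 ≤ t ∧ i % 2 = 1 ∧ p = sElx t α i

/-- span of the antichain indicators of the shared elements. -/
noncomputable def chiSharedSpan (t : ℕ) (α : ℕ → ℕ) : Submodule ℝ (J t α → ℝ) :=
  Submodule.span ℝ {f | ∃ i, 1 ≤ i ∧ i + 1 ≤ t ∧ f = chi t α (sElx t α i)}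

/-- span of the order-ideal indicators of the shared elements. -/
noncomputable def chiHatSharedSpan (t : ℕ) (α : ℕ → ℕ) : Submodule ℝ (J t α → ℝ) :=
  Submodule.span ℝ {f | ∃ i, 1 ≤ i ∧ i + 1 ≤ t ∧ f = chiHat t α (sElx t α i)}

theorem cov_elem {t : ℕ} {α : ℕ → ℕ} {a b : V t α} (h : Cov t α a b) :
    Elem t α a ∧ Elem t α b := by
  obtain ⟨i, hi, hd, h1, h2, h3, h4⟩ := h
  constructor <;> (simp only [Elem]; omega)

theorem le_elem {t : ℕ} {α : ℕ → ℕ} {a b : V t α} (h : Le t α a b) (hb : Elem t α b) :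
    Elem t α a := by
  induction h using Relation.ReflTransGen.head_induction_on with
  | refl => exact hb
  | head hc _ _ => exact (cov_elem hc).1

/-- rowmotion: `ρ(I)` is the order ideal generated by the minimal elements of the
complement of `I`. -/
noncomputable def rho (t : ℕ) (α : ℕ → ℕ) (I : J t α) : J t α :=
  ⟨{q | ∃ p : V t α, MinOut t α I.1 p ∧ Le t α q p}, by
    constructor
    · rintro q ⟨p, hp, hle⟩
      exact le_elem hle hp.1
    · rintro a b hab ⟨p, hp, hle⟩
      exact ⟨p, hp, Relation.ReflTransGen.trans hab hle⟩⟩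

/-- the (forward) orbit of `x` under `ρ`. -/
def orbit {X : Type*} (ρ : X → X) (x : X) : Set X := {y | ∃ k : ℕ, ρ^[k] x = y}

/-- `f` is `c`-mesic under `ρ`: the sum of `f` over each orbit is `c` times
the orbit size. -/
def IsMesic {X : Type*} (ρ : X → X) (f : X → ℝ) (c : ℝ) : Prop :=
  ∀ x : X, ∑ᶠ y ∈ orbit ρ x, f y = (orbit ρ x).ncard * c


/-! ### Structure of the covering relation -/

/-- the edge `(j, j+1)` ascends. -/
def Up (t : ℕ) (α : ℕ → ℕ) (j : ℕ) : Prop :=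
  ∃ i < t, i % 2 = 0 ∧ m α i ≤ j ∧ j < m α (i + 1)

theorem m_mono (α : ℕ → ℕ) : Monotone (m α) := by
  intro a b hab
  unfold m
  exact Finset.sum_le_sum_of_subset (by simpa using hab)

theorem m_unique {α : ℕ → ℕ} {i i' j : ℕ} (h1 : m α i ≤ j) (h2 : j < m α (i + 1))
    (h3 : m α i' ≤ j) (h4 : j < m α (i' + 1)) : i = i' := by
  rcases lt_trichotomy i i' with h | h | h
  · have := m_mono α (show i + 1 ≤ i' from h); omega
  · exact h
  · have := m_mono α (show i' + 1 ≤ i from h); omega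

theorem m_exists (α : ℕ → ℕ) (t j : ℕ) (h : j < m α t) :
    ∃ i < t, m α i ≤ j ∧ j < m α (i + 1) := by
  induction t with
  | zero => simp [m] at h
  | succ t ih =>
    by_cases hj : j < m α t
    · obtain ⟨i, hi, h'⟩ := ih hj
      exact ⟨i, by omega, h'⟩
    · exact ⟨t, by omega, by omega, h⟩

theorem cov_iff {t : ℕ} {α : ℕ → ℕ} (a b : V t α) :
    Cov t α a b ↔ (1 ≤ (a : ℕ) ∧ (b : ℕ) = a + 1 ∧ Up t α a) ∨
      (1 ≤ (b : ℕ) ∧ (a : ℕ) = b + 1 ∧ ¬ Up t α b) := by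
  have ha := a.2
  have hb := b.2
  constructor
  · rintro ⟨i, hi, hd, h1, h2, h3, h4⟩
    rcases hd with ⟨hp, h⟩ | ⟨hp, h⟩
    · left
      rw [show min (a : ℕ) b = a by omega] at *
      exact ⟨h3, h, i, hi, hp, h1, h2⟩
    · right
      rw [show min (a : ℕ) b = b by omega] at *
      refine ⟨h3, h, ?_⟩
      rintro ⟨i', hi', hp', h1', h2'⟩
      have := m_unique h1 h2 h1' h2'
      omega
  · rintro (⟨h1, h2, i, hi, hp, h3, h4⟩ | ⟨h1, h2, h3⟩)
    · refine ⟨i, hi, Or.inl ⟨hp, h2⟩, ?_⟩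
      rw [show min (a : ℕ) b = a by omega]
      exact ⟨h3, h4, h1, by omega⟩
    · obtain ⟨i, hi, h4, h5⟩ := m_exists α t b (by unfold nn at *; omega)
      have hp : i % 2 = 1 := by
        by_contra hp
        exact h3 ⟨i, hi, by omega, h4, h5⟩
      refine ⟨i, hi, Or.inr ⟨hp, h2⟩, ?_⟩
      rw [show min (a : ℕ) b = b by omega]
      exact ⟨h4, h5, h1, by omega⟩

theorem m_pal {t : ℕ} {α : ℕ → ℕ}
    (hpal : ∀ i, 1 ≤ i → i ≤ t → α (i - 1) = α (t - i)) (i : ℕ) (hi : i ≤ t) :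
    m α i + m α (t - i) = m α t := by
  induction i with
  | zero => simp [m]
  | succ i ih =>
    have h1 := ih (by omega)
    have h2 : m α (i + 1) = m α i + α i := Finset.sum_range_succ _ _
    have h3 : m α (t - (i + 1) + 1) = m α (t - (i + 1)) + α (t - (i + 1)) :=
      Finset.sum_range_succ _ _
    rw [show t - (i + 1) + 1 = t - i by omega] at h3
    have h4 := hpal (i + 1) (by omega) hi
    simp only [Nat.add_sub_cancel] at h4
    omega

theorem up_pal {t : ℕ} {α : ℕ → ℕ} (hodd : t % 2 = 1)
    (hpal : ∀ i, 1 ≤ i → i ≤ t → α (i - 1) = α (t - i)) {j : ℕ} (hj : j ≤ nn t α)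
    (h : Up t α j) : Up t α (nn t α - j) := by
  obtain ⟨i, hi, hp, h1, h2⟩ := h
  have h3 := m_pal hpal i hi.le
  have h4 := m_pal hpal (i + 1) hi
  refine ⟨t - (i + 1), by omega, by omega, ?_, ?_⟩
  · unfold nn at *; omega
  · rw [show t - (i + 1) + 1 = t - i by omega]
    unfold nn at *; omega

theorem up_pal_iff {t : ℕ} {α : ℕ → ℕ} (hodd : t % 2 = 1)
    (hpal : ∀ i, 1 ≤ i → i ≤ t → α (i - 1) = α (t - i)) {j : ℕ} (hj : j ≤ nn t α) :
    Up t α (nn t α - j) ↔ Up t α j := by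
  refine ⟨fun h => ?_, up_pal hodd hpal hj⟩
  have := up_pal hodd hpal (by omega) h
  rwa [show nn t α - (nn t α - j) = j by omega] at this

/-- the reflection `x_k ↦ x_{n-k+1}`. -/
def kap (t : ℕ) (α : ℕ → ℕ) (p : V t α) : V t α := xel t α (nn t α - p + 1)

theorem kap_val {t : ℕ} {α : ℕ → ℕ} {p : V t α} (hp : 1 ≤ (p : ℕ)) :
    (kap t α p : ℕ) = nn t α - p + 1 := by
  have := p.2
  simp only [kap, xel]
  exact Nat.mod_eq_of_lt (by omega)

theorem kap_elem {t : ℕ} {α : ℕ → ℕ} {p : V t α} (hp : Elem t α p) :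
    Elem t α (kap t α p) := by
  unfold Elem at *
  rw [kap_val hp]; omega

theorem kap_kap {t : ℕ} {α : ℕ → ℕ} {p : V t α} (hp : Elem t α p) :
    kap t α (kap t α p) = p := by
  have := p.2
  have h1 := kap_elem hp
  unfold Elem at *
  apply Fin.ext
  rw [kap_val h1, kap_val hp]; omega

theorem kap_cov {t : ℕ} {α : ℕ → ℕ} (hodd : t % 2 = 1)
    (hpal : ∀ i, 1 ≤ i → i ≤ t → α (i - 1) = α (t - i)) {a b : V t α} (h : Cov t α a b) :
    Cov t α (kap t α b) (kap t α a) := by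
  obtain ⟨hea, heb⟩ := cov_elem h
  have ha := a.2
  have hb := b.2
  unfold Elem at *
  rw [cov_iff] at *
  rw [kap_val hea, kap_val heb]
  rcases h with ⟨h1, h2, h3⟩ | ⟨h1, h2, h3⟩
  · left
    refine ⟨by omega, by omega, ?_⟩
    rw [show nn t α - b + 1 = nn t α - a by omega]
    exact (up_pal_iff hodd hpal (by omega)).2 h3
  · right
    refine ⟨by omega, by omega, ?_⟩
    rw [show nn t α - a + 1 = nn t α - b by omega]
    rwa [up_pal_iff hodd hpal (by omega)]

theorem cov_cases {t : ℕ} {α : ℕ → ℕ} (p : V t α) (hp : Elem t α p) :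
    (∀ q, ¬ Cov t α p q) ∨ (∀ q, ¬ Cov t α q p) ∨
    (∃ u l, Cov t α p u ∧ Cov t α l p ∧ (∀ q, Cov t α p q → q = u) ∧
      (∀ q, Cov t α q p → q = l)) := by
  have hlt := p.2
  unfold Elem at hp
  simp only [cov_iff]
  by_cases hu : Up t α p
  · by_cases hl : Up t α (p - 1)
    · by_cases h1 : (p : ℕ) = 1
      · right; left
        rintro q (⟨a, b, c⟩ | ⟨a, b, c⟩)
        · omega
        · exact c hu
      by_cases hn : (p : ℕ) = nn t α
      · left
        rintro q (⟨a, b, c⟩ | ⟨a, b, c⟩)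
        · have := q.2; omega
        · rw [show (p : ℕ) - 1 = q by omega] at hl
          exact c hl
      right; right
      refine ⟨⟨p + 1, by omega⟩, ⟨p - 1, by omega⟩, ?_, ?_, ?_, ?_⟩
      · left; exact ⟨hp, rfl, hu⟩
      · left; exact ⟨by simp only; omega, by simp only; omega, hl⟩
      · rintro q (⟨a, b, c⟩ | ⟨a, b, c⟩)
        · exact Fin.ext b
        · rw [show (p : ℕ) - 1 = q by omega] at hl
          exact absurd hl c
      · rintro q (⟨a, b, c⟩ | ⟨a, b, c⟩)
        · apply Fin.ext; simp only; omega
        · exact absurd hu c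
    · right; left
      rintro q (⟨a, b, c⟩ | ⟨a, b, c⟩)
      · rw [show (p : ℕ) - 1 = q by omega] at hl
        exact hl c
      · exact c hu
  · by_cases hl : Up t α (p - 1)
    · left
      rintro q (⟨a, b, c⟩ | ⟨a, b, c⟩)
      · exact hu c
      · rw [show (p : ℕ) - 1 = q by omega] at hl
        exact c hl
    · by_cases h1 : (p : ℕ) = 1
      · left
        rintro q (⟨a, b, c⟩ | ⟨a, b, c⟩)
        · exact hu c
        · omega
      by_cases hn : (p : ℕ) = nn t α
      · right; left
        rintro q (⟨a, b, c⟩ | ⟨a, b, c⟩)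
        · rw [show (p : ℕ) - 1 = q by omega] at hl
          exact hl c
        · have := q.2; omega
      right; right
      refine ⟨⟨p - 1, by omega⟩, ⟨p + 1, by omega⟩, ?_, ?_, ?_, ?_⟩
      · right; exact ⟨by simp only; omega, by simp only; omega, hl⟩
      · right; exact ⟨hp, rfl, hu⟩
      · rintro q (⟨a, b, c⟩ | ⟨a, b, c⟩)
        · exact absurd c hu
        · apply Fin.ext; simp only; omega
      · rintro q (⟨a, b, c⟩ | ⟨a, b, c⟩)
        · rw [show (p : ℕ) - 1 = q by omega] at hl
          exact absurd c hl
        · exact Fin.ext b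

/-- a rank function, increasing along the covering relation. -/
noncomputable def rk (t : ℕ) (α : ℕ → ℕ) (j : ℕ) : ℤ :=
  ∑ i ∈ Finset.range j, if Up t α i then 1 else -1

theorem rk_cov {t : ℕ} {α : ℕ → ℕ} {a b : V t α} (h : Cov t α a b) :
    rk t α a < rk t α b := by
  rw [cov_iff] at h
  rcases h with ⟨_, h2, h3⟩ | ⟨_, h2, h3⟩
  · rw [h2, rk, rk, Finset.sum_range_succ, if_pos h3]; omega
  · rw [h2, rk, rk, Finset.sum_range_succ, if_neg h3]; omega

theorem wf_down (t : ℕ) (α : ℕ → ℕ) :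
    WellFounded (fun a b : V t α => rk t α a < rk t α b) := by
  haveI : IsTrans (V t α) (fun a b : V t α => rk t α a < rk t α b) :=
    ⟨fun _ _ _ h1 h2 => lt_trans h1 h2⟩
  haveI : Std.Irrefl (fun a b : V t α => rk t α a < rk t α b) := ⟨fun _ h => lt_irrefl _ h⟩
  exact Finite.wellFounded_of_trans_of_irrefl _

theorem wf_up (t : ℕ) (α : ℕ → ℕ) :
    WellFounded (fun a b : V t α => rk t α b < rk t α a) := by
  haveI : IsTrans (V t α) (fun a b : V t α => rk t α b < rk t α a) :=
    ⟨fun _ _ _ h1 h2 => lt_trans h2 h1⟩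
  haveI : Std.Irrefl (fun a b : V t α => rk t α b < rk t α a) := ⟨fun _ h => lt_irrefl _ h⟩
  exact Finite.wellFounded_of_trans_of_irrefl _

/-! ### Maximal and minimal elements, rowmotion -/

theorem ideal_cov {t : ℕ} {α : ℕ → ℕ} (I : J t α) {a b : V t α} (h : Cov t α a b)
    (hb : b ∈ I.1) : a ∈ I.1 :=
  I.2.2 a b (Relation.ReflTransGen.single h) hb

theorem maxIn_iff {t : ℕ} {α : ℕ → ℕ} (I : J t α) (p : V t α) :
    MaxIn t α I.1 p ↔ p ∈ I.1 ∧ ∀ q, Cov t α p q → q ∉ I.1 := by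
  constructor
  · rintro ⟨h1, h2⟩
    refine ⟨h1, fun q hq hqI => ?_⟩
    have h3 := h2 q hqI (Relation.ReflTransGen.single hq)
    have h4 := rk_cov hq
    rw [h3] at h4
    exact lt_irrefl _ h4
  · rintro ⟨h1, h2⟩
    refine ⟨h1, fun q hq hle => ?_⟩
    rcases Relation.ReflTransGen.cases_head hle with h | ⟨r, hr, hrq⟩
    · exact h.symm
    · exact absurd (I.2.2 r q hrq hq) (h2 r hr)

theorem minOut_iff {t : ℕ} {α : ℕ → ℕ} (I : J t α) (p : V t α) (hp : Elem t α p) :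
    MinOut t α I.1 p ↔ p ∉ I.1 ∧ ∀ q, Cov t α q p → q ∈ I.1 := by
  constructor
  · rintro ⟨_, h1, h2⟩
    refine ⟨h1, fun q hq => ?_⟩
    by_contra hqI
    have h3 := h2 q (cov_elem hq).1 hqI (Relation.ReflTransGen.single hq)
    have h4 := rk_cov hq
    rw [h3] at h4
    exact lt_irrefl _ h4
  · rintro ⟨h1, h2⟩
    refine ⟨hp, h1, fun q _ hqI hle => ?_⟩
    rcases Relation.ReflTransGen.cases_tail hle with h | ⟨r, hqr, hr⟩
    · exact h.symm
    · exact absurd (I.2.2 q r hqr (h2 r hr)) hqI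

theorem maxIn_rho {t : ℕ} {α : ℕ → ℕ} (I : J t α) (p : V t α) :
    MaxIn t α (rho t α I).1 p ↔ MinOut t α I.1 p := by
  constructor
  · rintro ⟨⟨p', hp', hle⟩, h2⟩
    have := h2 p' ⟨p', hp', Relation.ReflTransGen.refl⟩ hle
    rwa [← this]
  · intro h
    refine ⟨⟨p, h, Relation.ReflTransGen.refl⟩, ?_⟩
    rintro q ⟨p', hp', hqp'⟩ hpq
    have h1 : p = p' := hp'.2.2 p h.1 h.2.1 (Relation.ReflTransGen.trans hpq hqp')
    subst h1
    refine h.2.2 q (le_elem hqp' h.1) (fun hq => ?_) hqp'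
    exact h.2.1 (I.2.2 p q hpq hq)

theorem exists_minOut {t : ℕ} {α : ℕ → ℕ} (I : J t α) (q : V t α) (hq : Elem t α q)
    (hqI : q ∉ I.1) : ∃ p, MinOut t α I.1 p ∧ Le t α p q := by
  induction q using (wf_down t α).induction with
  | _ q ih =>
    by_cases h : ∀ r, Cov t α r q → r ∈ I.1
    · exact ⟨q, (minOut_iff I q hq).2 ⟨hqI, h⟩, Relation.ReflTransGen.refl⟩
    · push Not at h
      obtain ⟨r, hr, hrI⟩ := h
      obtain ⟨p, hp, hle⟩ := ih r (rk_cov hr) (cov_elem hr).1 hrI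
      exact ⟨p, hp, Relation.ReflTransGen.tail hle hr⟩

theorem rho_inj (t : ℕ) (α : ℕ → ℕ) : Function.Injective (rho t α) := by
  have key : ∀ I I' : J t α, rho t α I = rho t α I' → I.1 ⊆ I'.1 := by
    intro I I' h q hq
    by_contra hq'
    obtain ⟨p, hp, hle⟩ := exists_minOut I' q (I.2.1 q hq) hq'
    rw [← maxIn_rho, ← h, maxIn_rho] at hp
    exact hp.2.1 (I.2.2 p q hle hq)
  intro I I' h
  exact Subtype.ext (Set.Subset.antisymm (key _ _ h) (key _ _ h.symm))

/-! ### Sums over an orbit -/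

/-- the orbit as a finset. -/
noncomputable def orb {t : ℕ} {α : ℕ → ℕ} (x : J t α) : Finset (J t α) :=
  (Set.toFinite (orbit (rho t α) x)).toFinset

theorem sum_rho {t : ℕ} {α : ℕ → ℕ} (x : J t α) (f : J t α → ℝ) :
    ∑ I ∈ orb x, f (rho t α I) = ∑ I ∈ orb x, f I := by
  have hsub : (orb x).image (rho t α) ⊆ orb x := by
    intro y hy
    simp only [orb, Finset.mem_image, Set.Finite.mem_toFinset] at *
    obtain ⟨z, ⟨k, hk⟩, rfl⟩ := hy
    exact ⟨k + 1, by rw [Function.iterate_succ_apply', hk]⟩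
  have heq : (orb x).image (rho t α) = orb x :=
    Finset.eq_of_subset_of_card_le hsub
      (Finset.card_image_of_injective _ (rho_inj t α)).ge
  conv_rhs => rw [← heq]
  rw [Finset.sum_image]
  exact fun a _ b _ h => rho_inj t α h

theorem mesic_iff {t : ℕ} {α : ℕ → ℕ} (f : J t α → ℝ) (c : ℝ) :
    IsMesic (rho t α) f c ↔ ∀ x, ∑ I ∈ orb x, f I = (orb x).card * c := by
  unfold IsMesic
  refine forall_congr' fun x => ?_
  rw [finsum_mem_eq_finite_toFinset_sum _ (Set.toFinite (orbit (rho t α) x)),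
    Set.ncard_eq_toFinset_card _ (Set.toFinite (orbit (rho t α) x))]
  rfl

/-- orbit sum of the antichain indicator. -/
noncomputable def cS {t : ℕ} {α : ℕ → ℕ} (x : J t α) (p : V t α) : ℝ :=
  ∑ I ∈ orb x, chi t α p I

/-- orbit sum of the order-ideal indicator. -/
noncomputable def hS {t : ℕ} {α : ℕ → ℕ} (x : J t α) (p : V t α) : ℝ :=
  ∑ I ∈ orb x, chiHat t α p I

theorem cS_eq_minOut {t : ℕ} {α : ℕ → ℕ} (x : J t α) (p : V t α) :
    cS x p = ∑ I ∈ orb x, if MinOut t α I.1 p then (1 : ℝ) else 0 := by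
  rw [cS, ← sum_rho]
  refine Finset.sum_congr rfl fun I _ => ?_
  simp only [chi, maxIn_rho]

theorem cS_max {t : ℕ} {α : ℕ → ℕ} (x : J t α) (p : V t α) (h : ∀ q, ¬ Cov t α p q) :
    cS x p = hS x p := by
  refine Finset.sum_congr rfl fun I _ => ?_
  simp [chi, chiHat, maxIn_iff, h]

theorem cS_min {t : ℕ} {α : ℕ → ℕ} (x : J t α) (p : V t α) (hp : Elem t α p)
    (h : ∀ q, ¬ Cov t α q p) : cS x p = (orb x).card - hS x p := by
  have h1 : ((orb x).card : ℝ) = ∑ I ∈ orb x, (1 : ℝ) := by simp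
  rw [cS_eq_minOut, hS, h1, ← Finset.sum_sub_distrib]
  refine Finset.sum_congr rfl fun I _ => ?_
  by_cases hpI : p ∈ I.1 <;> simp [chiHat, minOut_iff, hp, h, hpI]

theorem cS_up {t : ℕ} {α : ℕ → ℕ} (x : J t α) (p u : V t α) (hu : Cov t α p u)
    (h : ∀ q, Cov t α p q → q = u) : cS x p = hS x p - hS x u := by
  rw [cS, hS, hS, ← Finset.sum_sub_distrib]
  refine Finset.sum_congr rfl fun I _ => ?_
  have h1 : MaxIn t α I.1 p ↔ p ∈ I.1 ∧ u ∉ I.1 := by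
    rw [maxIn_iff]
    exact and_congr_right fun _ => ⟨fun h' => h' u hu, fun h' q hq => by rwa [h q hq]⟩
  have h2 := ideal_cov I hu
  simp only [chi, chiHat, h1]
  by_cases hpI : p ∈ I.1 <;> by_cases huI : u ∈ I.1 <;> simp_all

theorem cS_down {t : ℕ} {α : ℕ → ℕ} (x : J t α) (p l : V t α) (hl : Cov t α l p)
    (h : ∀ q, Cov t α q p → q = l) : cS x p = hS x l - hS x p := by
  rw [cS_eq_minOut, hS, hS, ← Finset.sum_sub_distrib]
  refine Finset.sum_congr rfl fun I _ => ?_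
  have h1 : MinOut t α I.1 p ↔ p ∉ I.1 ∧ l ∈ I.1 := by
    rw [minOut_iff I p (cov_elem hl).2]
    exact and_congr_right fun _ => ⟨fun h' => h' l hl, fun h' q hq => by rwa [h q hq]⟩
  have h2 := ideal_cov I hl
  simp only [chiHat, h1]
  by_cases hpI : p ∈ I.1 <;> by_cases huI : l ∈ I.1 <;> simp_all

/-- the equivalence for a single orbit. -/
theorem orbit_iff {t : ℕ} {α : ℕ → ℕ} (hodd : t % 2 = 1)
    (hpal : ∀ i, 1 ≤ i → i ≤ t → α (i - 1) = α (t - i)) (x : J t α) :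
    (∀ p, Elem t α p → cS x p = cS x (kap t α p)) ↔
    (∀ p, Elem t α p → hS x p + hS x (kap t α p) = (orb x).card) := by
  have kc : ∀ {a b : V t α}, Cov t α a b → Cov t α (kap t α b) (kap t α a) :=
    fun h => kap_cov hodd hpal h
  have hmax : ∀ p, Elem t α p → (∀ q, ¬ Cov t α p q) →
      cS x p = hS x p ∧ cS x (kap t α p) = (orb x).card - hS x (kap t α p) := by
    refine fun p hp h => ⟨cS_max x p h, cS_min x _ (kap_elem hp) fun q hq => ?_⟩
    have := kc hq
    rw [kap_kap hp] at this
    exact h _ this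
  have hmin : ∀ p, Elem t α p → (∀ q, ¬ Cov t α q p) →
      cS x p = (orb x).card - hS x p ∧ cS x (kap t α p) = hS x (kap t α p) := by
    refine fun p hp h => ⟨cS_min x p hp h, cS_max x _ fun q hq => ?_⟩
    have := kc hq
    rw [kap_kap hp] at this
    exact h _ this
  have hmid : ∀ p u, Elem t α p → Cov t α p u → (∀ q, Cov t α p q → q = u) →
      cS x p = hS x p - hS x u ∧
      cS x (kap t α p) = hS x (kap t α u) - hS x (kap t α p) := by
    refine fun p u hp hu h => ⟨cS_up x p u hu h, cS_down x _ _ (kc hu) fun q hq => ?_⟩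
    have h1 := kc hq
    rw [kap_kap hp] at h1
    rw [← h _ h1, kap_kap (cov_elem hq).1]
  constructor
  · intro H p hp
    induction p using (wf_up t α).induction with
    | _ p ih =>
      have hH := H p hp
      rcases cov_cases p hp with h | h | ⟨u, l, hu, _, huu, _⟩
      · obtain ⟨h1, h2⟩ := hmax p hp h; linarith
      · obtain ⟨h1, h2⟩ := hmin p hp h; linarith
      · obtain ⟨h1, h2⟩ := hmid p u hp hu huu
        have h3 := ih u (rk_cov hu) (cov_elem hu).2
        linarith
  · intro H p hp
    have hH := H p hp
    rcases cov_cases p hp with h | h | ⟨u, l, hu, _, huu, _⟩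
    · obtain ⟨h1, h2⟩ := hmax p hp h; linarith
    · obtain ⟨h1, h2⟩ := hmin p hp h; linarith
    · obtain ⟨h1, h2⟩ := hmid p u hp hu huu
      have h3 := H u (cov_elem hu).2
      linarith

theorem forall_elem {t : ℕ} {α : ℕ → ℕ} (P : V t α → V t α → Prop) :
    (∀ k, 1 ≤ k → k ≤ nn t α → P (xel t α k) (xel t α (nn t α - k + 1))) ↔
    ∀ p, Elem t α p → P p (kap t α p) := by
  have hv : ∀ k, k ≤ nn t α → (xel t α k : ℕ) = k := fun k hk =>
    Nat.mod_eq_of_lt (by omega)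
  constructor
  · intro h p hp
    have h1 := h p hp (by have := p.2; omega)
    have h2 : xel t α p = p := Fin.ext (hv _ (by have := p.2; omega))
    rw [h2] at h1
    exact h1
  · intro h k hk hkn
    have h1 := h (xel t α k) (by unfold Elem; rw [hv k hkn]; exact hk)
    rw [kap, hv k hkn] at h1
    exact h1

/-- Corollary `rof iff`.
For a palindromic `α` with `t` odd: the statistics `χ_{x_k} − χ_{x_{n−k+1}}` are 0-mesic
for all `k ∈ [n]` iff the statistics `χ̂_{x_k} + χ̂_{x_{n−k+1}}` are 1-mesic for all `k ∈ [n]`. -/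
theorem statement13 (t : ℕ) (α : ℕ → ℕ) (hF : IsFence t α) (hodd : t % 2 = 1)
    (hpal : ∀ i, 1 ≤ i → i ≤ t → α (i - 1) = α (t - i)) :
    (∀ k, 1 ≤ k → k ≤ nn t α →
      IsMesic (rho t α)
        (fun I => chi t α (xel t α k) I - chi t α (xel t α (nn t α - k + 1)) I) 0)
    ↔ (∀ k, 1 ≤ k → k ≤ nn t α →
      IsMesic (rho t α)
        (fun I => chiHat t α (xel t α k) I + chiHat t α (xel t α (nn t α - k + 1)) I) 1) := by
  rw [forall_elem (fun p q => IsMesic (rho t α) (fun I => chi t α p I - chi t α q I) 0),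
    forall_elem (fun p q => IsMesic (rho t α) (fun I => chiHat t α p I + chiHat t α q I) 1)]
  simp only [mesic_iff, Finset.sum_sub_distrib, Finset.sum_add_distrib, mul_zero, mul_one,
    sub_eq_zero]
  constructor
  · intro h p hp x
    exact (orbit_iff hodd hpal x).1 (fun p hp => h p hp x) p hp
  · intro h p hp x
    exact (orbit_iff hodd hpal x).2 (fun p hp => h p hp x) p hp

end Fence
end

section
/- Let P be a finite self-dual poset and let κ : P → P be an order-reversing involution. For an order ideal I ∈ J(P), let I′ denote the order ideal generated by the set κ(max(I)), where max(I) is the set of maximal elements of I. Then for all I ∈ J(P), ρ^{−1}(I′) = (ρ(I))′; equivalently, ρ((ρ(I))′) = I′. -/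
open scoped Classical

namespace Row

variable {P : Type*} [PartialOrder P] [Fintype P]

/-- the order ideals (lower sets) of `P`. -/
abbrev OIdeal (P : Type*) [PartialOrder P] := {S : Set P // IsLowerSet S}

/-- the set of maximal elements of `S`. -/
def maxIn (S : Set P) : Set P := {p | p ∈ S ∧ ∀ q ∈ S, p ≤ q → q = p}

/-- the set of minimal elements of the complement of `S`. -/
def minOut (S : Set P) : Set P := {p | p ∉ S ∧ ∀ q ∉ S, q ≤ p → q = p}

/-- rowmotion: `ρ(I)` is the order ideal generated by the minimal elements of `P ∖ I`. -/
def rho (I : OIdeal P) : OIdeal P :=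
  ⟨{x | ∃ y ∈ minOut I.1, x ≤ y}, by
    intro u v hle hu
    obtain ⟨y, hy, h⟩ := hu
    exact ⟨y, hy, hle.trans h⟩⟩

/-- the order ideal generated by a set `A`. -/
def genIdeal (A : Set P) : OIdeal P :=
  ⟨{x | ∃ y ∈ A, x ≤ y}, by
    intro u v hle hu
    obtain ⟨y, hy, h⟩ := hu
    exact ⟨y, hy, hle.trans h⟩⟩

/-- `I′`: the order ideal generated by `κ(max I)`. -/
def primeI (κ : P → P) (I : OIdeal P) : OIdeal P := genIdeal (κ '' maxIn I.1)

/-- the antichain indicator `χ_p(I)`. -/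
noncomputable def chiA (p : P) (I : OIdeal P) : ℝ := if p ∈ maxIn I.1 then 1 else 0

/-- the (forward) orbit of `x` under `ρ`. -/
def orbit {X : Type*} (ρ : X → X) (x : X) : Set X := {y | ∃ k : ℕ, ρ^[k] x = y}


theorem maxIn_rho (I : OIdeal P) : maxIn (rho I).1 = minOut I.1 := by
  ext p
  constructor
  · rintro ⟨⟨y, hy, hpy⟩, h⟩
    have := h y ⟨y, hy, le_rfl⟩ hpy
    exact this ▸ hy
  · intro hp
    refine ⟨⟨p, hp, le_rfl⟩, ?_⟩
    rintro q ⟨y, hy, hqy⟩ hpq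
    have := hy.2 p hp.1 (hpq.trans hqy)
    subst this
    exact le_antisymm hqy hpq

theorem exists_minOut (S : Set P) (x : P) (hx : x ∉ S) : ∃ m ∈ minOut S, m ≤ x := by
  obtain ⟨m, hmx, hm⟩ := (Set.toFinite Sᶜ).exists_le_minimal hx
  exact ⟨m, ⟨hm.1, fun q hq hle => le_antisymm hle (hm.2 hq hle)⟩, hmx⟩

theorem mem_primeI_rho (κ : P → P) (hinv : Function.Involutive κ)
    (hrev : ∀ x y : P, x ≤ y → κ y ≤ κ x) (I : OIdeal P) (x : P) :
    x ∈ (primeI κ (rho I)).1 ↔ κ x ∉ I.1 := by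
  unfold primeI
  rw [maxIn_rho]
  constructor
  · rintro ⟨_, ⟨m, hm, rfl⟩, hx⟩ hk
    have h := hrev _ _ hx
    rw [hinv m] at h
    exact hm.1 (I.2 h hk)
  · intro hk
    obtain ⟨m, hm, hle⟩ := exists_minOut I.1 _ hk
    have h := hrev _ _ hle
    rw [hinv x] at h
    exact ⟨κ m, ⟨m, hm, rfl⟩, h⟩

theorem minOut_primeI_rho (κ : P → P) (hinv : Function.Involutive κ)
    (hrev : ∀ x y : P, x ≤ y → κ y ≤ κ x) (I : OIdeal P) :
    minOut (primeI κ (rho I)).1 = κ '' maxIn I.1 := by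
  ext p
  simp only [minOut, mem_primeI_rho κ hinv hrev, not_not, Set.mem_setOf_eq]
  constructor
  · rintro ⟨hp, h⟩
    refine ⟨κ p, ⟨hp, fun q hq hle => ?_⟩, hinv p⟩
    have h1 := hrev _ _ hle
    rw [hinv p] at h1
    rw [← h (κ q) (by rwa [hinv q]) h1, hinv q]
  · rintro ⟨m, hm, rfl⟩
    refine ⟨by rw [hinv m]; exact hm.1, fun q hq hle => ?_⟩
    have h1 := hrev _ _ hle
    rw [hinv m] at h1
    rw [← hm.2 _ hq h1, hinv q]

/-- Lemma `prime rho rel`.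
For a finite self-dual poset `P` with an order-reversing involution `κ`, letting
`I′` be the order ideal generated by `κ(max(I))`, one has `ρ⁻¹(I′) = (ρ(I))′`;
equivalently, `ρ((ρ(I))′) = I′`. -/
theorem statement14 {P : Type*} [PartialOrder P] [Fintype P]
    (κ : P → P) (hinv : Function.Involutive κ)
    (hrev : ∀ x y : P, x ≤ y → κ y ≤ κ x)
    (I : OIdeal P) :
    rho (primeI κ (rho I)) = primeI κ I := by
  apply Subtype.ext
  show {x | ∃ y ∈ minOut (primeI κ (rho I)).1, x ≤ y} = {x | ∃ y ∈ κ '' maxIn I.1, x ≤ y}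
  rw [minOut_primeI_rho κ hinv hrev]

end Row
end

section
/- Let a ≥ 2 and let F = F̆(a,a) be the fence with two segments of the same size. Then for any choice of parameters α^B, ω^B ∈ ℝ_{>0} and any linear extension of F used to define birational rowmotion ρ^B on labelings π : F → ℝ_{>0}, the map ρ^B has order exactly a(a+1): (ρ^B)^{a(a+1)} is the identity on ℝ_{>0}^F, and no smaller positive power of ρ^B is the identity. -/
open scoped Classical

namespace Birational

variable {P : Type*} [PartialOrder P] [Fintype P]

/-- the poset `P̂ = P ∪ {0̂, 1̂}`. -/
abbrev Phat (P : Type*) := WithBot (WithTop P)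

/-- the inclusion `P → P̂`. -/
def toHat (p : P) : Phat P := ((p : WithTop P) : WithBot (WithTop P))

/-- extend a labeling `π : P → ℝ` to `P̂` by `π(0̂) = aB` and `π(1̂) = wB`. -/
noncomputable def extLab (aB wB : ℝ) (π : P → ℝ) : Phat P → ℝ :=
  WithBot.recBotCoe aB (WithTop.recTopCoe wB π)

/-- `Σ_{r ⋖ p in P̂} π̂(r)`. -/
noncomputable def belowSum (aB wB : ℝ) (π : P → ℝ) (p : P) : ℝ :=
  ∑ᶠ r ∈ {r : Phat P | r ⋖ toHat p}, extLab aB wB π r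

/-- `Σ_{p ⋖ r in P̂} π̂(r)⁻¹`. -/
noncomputable def aboveInvSum (aB wB : ℝ) (π : P → ℝ) (p : P) : ℝ :=
  ∑ᶠ r ∈ {r : Phat P | toHat p ⋖ r}, (extLab aB wB π r)⁻¹

/-- the birational toggle `τ_p^B`. -/
noncomputable def btoggle (aB wB : ℝ) (p : P) (π : P → ℝ) : P → ℝ :=
  fun q => if q = p then belowSum aB wB π p / (π p * aboveInvSum aB wB π p) else π q

/-- `e` enumerates a linear extension `p_1, …, p_n` of `P` (via `p_i = e (i-1)`). -/
def IsLinearExtension (e : Fin (Fintype.card P) ≃ P) : Prop :=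
  ∀ i j : Fin (Fintype.card P), e i ≤ e j → i ≤ j

/-- birational rowmotion `ρ^B = τ_{p_1}^B ∘ ⋯ ∘ τ_{p_n}^B` (toggled right to left). -/
noncomputable def brho (aB wB : ℝ) (e : Fin (Fintype.card P) ≃ P) : (P → ℝ) → P → ℝ :=
  (List.finRange (Fintype.card P)).foldr (fun i g => btoggle aB wB (e i) ∘ g) id

/-- `T_p^{+,B}`. -/
noncomputable def TplusB (aB wB : ℝ) (p : P) (π : P → ℝ) : ℝ :=
  π p / belowSum aB wB π p

/-- `T_p^{−,B}`. -/
noncomputable def TminusB (aB wB : ℝ) (p : P) (π : P → ℝ) : ℝ :=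
  1 / (π p * aboveInvSum aB wB π p)

/-- the birational toggleability statistic `T_p^B = T_p^{+,B} / T_p^{−,B}`. -/
noncomputable def TB (aB wB : ℝ) (p : P) (π : P → ℝ) : ℝ :=
  TplusB aB wB p π / TminusB aB wB p π


/-- the fence `F̆(a,a)`: elements `x_1, …, x_{2a−1}` (0-based indices `0, …, 2a−2`),
an increasing chain `x_1 ⋖ ⋯ ⋖ x_a` followed by a decreasing chain `x_a ⋗ ⋯ ⋗ x_{2a−1}`. -/
def FenceAA (a : ℕ) : Type := Fin (2 * a - 1)

/-- the 0-based index of an element of `F̆(a,a)`. -/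
def FenceAA.idx {a : ℕ} (x : FenceAA a) : ℕ := Fin.val (show Fin (2 * a - 1) from x)

instance (a : ℕ) : Fintype (FenceAA a) := inferInstanceAs (Fintype (Fin (2 * a - 1)))

instance (a : ℕ) : DecidableEq (FenceAA a) := inferInstanceAs (DecidableEq (Fin (2 * a - 1)))

/-- the order of `F̆(a,a)`: the peak is the element with index `a − 1`; indices `≤ a − 1`
form an increasing chain and indices `≥ a − 1` a decreasing chain. -/
def fenceAALE (a : ℕ) (x y : FenceAA a) : Prop :=
  (FenceAA.idx x ≤ FenceAA.idx y ∧ FenceAA.idx y ≤ a - 1)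
    ∨ (FenceAA.idx y ≤ FenceAA.idx x ∧ a - 1 ≤ FenceAA.idx y)

theorem FenceAA.idx_inj {a : ℕ} {x y : FenceAA a} (h : FenceAA.idx x = FenceAA.idx y) :
    x = y := by
  unfold FenceAA.idx at h
  exact Fin.ext h

instance (a : ℕ) : PartialOrder (FenceAA a) where
  le := fenceAALE a
  le_refl x := by
    show fenceAALE a x x
    unfold fenceAALE
    omega
  le_trans x y z h1 h2 := by
    have h1' : fenceAALE a x y := h1
    have h2' : fenceAALE a y z := h2
    show fenceAALE a x z
    unfold fenceAALE at h1' h2' ⊢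
    omega
  le_antisymm x y h1 h2 := by
    have h1' : fenceAALE a x y := h1
    have h2' : fenceAALE a y x := h2
    refine FenceAA.idx_inj ?_
    unfold fenceAALE at h1' h2'
    omega


structure Sys (b : ℕ) (A W : ℝ) (L R : ℕ → ℕ → ℝ) : Prop where
  hW : 0 < W
  hA : 0 < A
  Lpos : ∀ n i, 0 < L n i
  Rpos : ∀ n i, 0 < R n i
  L0 : ∀ n, L n 0 = A
  R0 : ∀ n, R n 0 = A
  top : ∀ n, L n (b+1) = R n (b+1)
  Lst : ∀ n i, i < b → L (n+1) (i+1) * L n (i+1) = L n i * L (n+1) (i+2)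
  Rst : ∀ n i, i < b → R (n+1) (i+1) * R n (i+1) = R n i * R (n+1) (i+2)
  T : ∀ n, L (n+1) (b+1) * L n (b+1) = (L n b + R n b) * W

namespace Sys
variable {b : ℕ} {A W : ℝ} {L R : ℕ → ℕ → ℝ}

theorem symm (h : Sys b A W L R) : Sys b A W R L where
  hW := h.hW
  hA := h.hA
  Lpos := h.Rpos
  Rpos := h.Lpos
  L0 := h.R0
  R0 := h.L0
  top n := (h.top n).symm
  Lst := h.Rst
  Rst := h.Lst
  T n := by rw [← h.top, ← h.top, h.T, add_comm]

/-- the sequence of consecutive ratios -/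
noncomputable def w (b : ℕ) (L : ℕ → ℕ → ℝ) (n : ℕ) : ℝ := L n (b+1) / L n b

theorem w_pos (h : Sys b A W L R) (n : ℕ) : 0 < w b L n := div_pos (h.Lpos _ _) (h.Lpos _ _)

theorem ratio (h : Sys b A W L R) (j : ℕ) : ∀ n i, i + j = b →
    L n (i+1) / L n i = w b L (n + j) := by
  induction j with
  | zero => intro n i hi; simp at hi; subst hi; rfl
  | succ j ih =>
    intro n i hi
    have := ih (n+1) (i+1) (by omega)
    rw [show n + (j+1) = n + 1 + j by ring, ← this]
    have h1 := h.Lst n i (by omega)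
    have := h.Lpos n i
    have := h.Lpos (n+1) (i+1)
    rw [div_eq_div_iff (by positivity) (by positivity)]
    linarith

theorem L_eq (h : Sys b A W L R) (n i : ℕ) (hi : i ≤ b + 1) :
    L n i = A * ∏ j ∈ Finset.range i, w b L (n + (b - j)) := by
  induction i with
  | zero => simp [h.L0]
  | succ i ih =>
    rw [Finset.prod_range_succ, ← mul_assoc, ← ih (by omega),
      ← h.ratio (b - i) n i (by omega), mul_div_cancel₀ _ (h.Lpos n i).ne']

theorem top_eq (h : Sys b A W L R) (n : ℕ) :
    L n (b+1) = A * ∏ j ∈ Finset.range (b+1), w b L (n + j) := by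
  rw [h.L_eq n _ le_rfl, ← Finset.prod_range_reflect]
  congr 1
  apply Finset.prod_congr rfl
  intro j hj
  simp at hj
  congr 2
  omega

noncomputable def q (b : ℕ) (L R : ℕ → ℕ → ℝ) (n : ℕ) : ℝ := w b L n / w b R n

theorem q_pos (h : Sys b A W L R) (n : ℕ) : 0 < q b L R n :=
  div_pos (h.w_pos _) (h.symm.w_pos _)

theorem new_w (h : Sys b A W L R) (n : ℕ) :
    w b L (n + (b + 1)) = L (n+1) (b+1) / L n b := by
  have h1 := h.ratio b (n+1) 0 (by omega)
  rw [show n + (b+1) = n + 1 + b by ring, ← h1]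
  have h2 := h.Lpos n b
  rcases b with _ | b
  · simp [h.L0]
  have h3 := h.ratio b (n+1) 1 (by omega)
  -- use product formulas
  have e1 := h.L_eq (n+1) (b+1+1) le_rfl
  rw [Finset.prod_range_succ'] at e1
  have e2 := h.L_eq n (b+1) (by omega)
  have e3 : ∏ k ∈ Finset.range (b+1), w (b+1) L (n + 1 + (b + 1 - (k + 1)))
     = ∏ k ∈ Finset.range (b+1), w (b+1) L (n + (b + 1 - k)) := by
    apply Finset.prod_congr rfl
    intro j hj
    simp at hj
    congr 1
    omega
  rw [e3, ← mul_assoc, ← e2] at e1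
  rw [h1, e1]
  simp
  field_simp

theorem q_per (h : Sys b A W L R) (n : ℕ) : q b L R (n + (b+1)) = q b L R n := by
  unfold q
  rw [h.new_w, h.symm.new_w, w, w, h.top, h.top]
  have := h.Lpos n b
  have := h.Rpos n b
  have := h.Rpos n (b+1)
  have := h.Rpos (n+1) (b+1)
  field_simp

theorem q_mod (h : Sys b A W L R) (n : ℕ) : q b L R (n % (b+1)) = q b L R n :=
  Function.Periodic.map_mod_nat (h.q_per) n

theorem w_prod (h : Sys b A W L R) (n : ℕ) :
    A * ∏ j ∈ Finset.range (b+2), w b L (n + j) = W * (1 + q b L R n) := by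
  rw [Finset.prod_range_succ, ← mul_assoc, ← h.top_eq, h.new_w, q, w, w, ← h.top]
  have := h.Lpos n b
  have := h.Rpos n b
  have := h.Lpos n (b+1)
  have := h.T n
  field_simp
  linarith

theorem w_step (h : Sys b A W L R) (n : ℕ) :
    w b L (n + (b+2)) * (1 + q b L R n) = w b L n * (1 + q b L R (n+1)) := by
  have h1 := h.w_prod n
  have h2 := h.w_prod (n+1)
  rw [Finset.prod_range_succ'] at h1
  rw [Finset.prod_range_succ] at h2
  have e : ∏ k ∈ Finset.range (b+1), w b L (n + (k+1)) =
    ∏ k ∈ Finset.range (b+1), w b L (n + 1 + k) :=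
    Finset.prod_congr rfl fun k _ => by congr 1; ring
  rw [e] at h1
  rw [show n + 1 + (b+1) = n + (b+2) by ring] at h2
  simp only [add_zero] at h1
  have := h.hW
  apply mul_left_cancel₀ this.ne'
  linear_combination (- w b L (n+(b+2))) * h1 + w b L n * h2

theorem w_steps (h : Sys b A W L R) (n m : ℕ) :
    w b L (n + m * (b+2)) * (1 + q b L R n) = w b L n * (1 + q b L R (n+m)) := by
  induction m with
  | zero => simp
  | succ m ih =>
    have h1 := h.w_step (n + m * (b+2))
    rw [← h.q_mod (n + m * (b+2)), ← h.q_mod (n + m * (b+2) + 1)] at h1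
    rw [show (n + m * (b+2)) % (b+1) = (n + m) % (b+1) by
      rw [show n + m * (b+2) = n + m + (b+1) * m by ring, Nat.add_mul_mod_self_left],
      show (n + m * (b+2) + 1) % (b+1) = (n + (m + 1)) % (b+1) by
      rw [show n + m * (b+2) + 1 = n + (m + 1) + (b+1) * m by ring, Nat.add_mul_mod_self_left],
      h.q_mod, h.q_mod, show n + m * (b+2) + (b+2) = n + (m+1) * (b+2) by ring] at h1
    have := h.q_pos (n+m)
    have h3 : (1 + q b L R (n+m)) ≠ 0 := by positivity
    apply mul_left_cancel₀ h3
    linear_combination (1 + q b L R n) * h1 + (1 + q b L R (n+(m+1))) * ih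

theorem w_period (h : Sys b A W L R) (n : ℕ) : w b L (n + (b+1) * (b+2)) = w b L n := by
  have h1 := h.w_steps n (b+1)
  rw [h.q_per] at h1
  have := h.q_pos n
  exact mul_right_cancel₀ (by positivity) h1

theorem L_period (h : Sys b A W L R) (n i : ℕ) (hi : i ≤ b+1) :
    L (n + (b+1) * (b+2)) i = L n i := by
  rw [h.L_eq _ i hi, h.L_eq n i hi]
  congr 1
  apply Finset.prod_congr rfl
  intro j _
  rw [← h.w_period (n + (b - j))]
  congr 1
  ring

/-- witness 1 -/
theorem wit1 (h : Sys b A W L R) (hb : 1 ≤ b) (hL : L 0 b = 2 * A)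
    (hL' : ∀ i, i ≤ b + 1 → i ≠ b → L 0 i = A) (hR : ∀ i, i ≤ b + 1 → R 0 i = A)
    (k : ℕ) (hk : q b L R k = q b L R 0) : (b + 1) ∣ k := by
  rw [← h.q_mod] at hk
  have hm : k % (b+1) < b + 1 := Nat.mod_lt _ (by omega)
  rw [Nat.dvd_iff_mod_eq_zero]
  by_contra hne
  generalize k % (b+1) = m at *
  have hA := h.hA
  have q0 : q b L R 0 = 1/2 := by
    unfold q w
    rw [hL, hL' (b+1) le_rfl (by omega), hR _ (by omega), hR _ (by omega)]
    field_simp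
  have e1 := h.ratio m 0 (b - m) (by omega)
  have e2 := h.symm.ratio m 0 (b - m) (by omega)
  rw [zero_add] at e1 e2
  rw [q0, q, ← e1, ← e2, hR _ (by omega), hR _ (by omega), hL' (b-m) (by omega) (by omega)] at hk
  by_cases h1 : m = 1
  · subst h1
    rw [show b - 1 + 1 = b by omega, hL] at hk
    field_simp at hk
    norm_num at hk
  · rw [hL' _ (by omega) (by omega)] at hk
    field_simp at hk
    norm_num at hk

/-- witness 2 -/
theorem wit2 (h : Sys b A W L R) (hL : L 0 (b+1) = A * (2 + 2 * (W / A)))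
    (hL' : ∀ i, i ≤ b → L 0 i = A) (hR : ∀ i, i ≤ b + 1 → R 0 i = L 0 i)
    (k : ℕ) (hk : w b L k = w b L 0) : (b + 2) ∣ k := by
  have hA := h.hA
  have hW := h.hW
  have hq : ∀ n, q b L R n = 1 := by
    intro n
    rw [← h.q_mod]
    have hm : n % (b+1) < b + 1 := Nat.mod_lt _ (by omega)
    generalize n % (b+1) = m at *
    have e1 := h.ratio m 0 (b - m) (by omega)
    have e2 := h.symm.ratio m 0 (b - m) (by omega)
    rw [hR _ (by omega), hR _ (by omega), e1, zero_add] at e2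
    rw [q, ← e2]
    exact div_self (h.w_pos _).ne'
  have hp : ∀ n, w b L (n + (b+2)) = w b L n := by
    intro n
    have := h.w_step n
    rw [hq, hq] at this
    linarith
  have hmod : w b L (k % (b+2)) = w b L k := Function.Periodic.map_mod_nat hp k
  rw [← hmod] at hk
  have hm : k % (b+2) < b + 2 := Nat.mod_lt _ (by omega)
  rw [Nat.dvd_iff_mod_eq_zero]
  by_contra hne
  generalize k % (b+2) = m at *
  have hc : 0 < W / A := by positivity
  have w0 : w b L 0 = 2 + 2 * (W/A) := by
    unfold w
    rw [hL, hL' b le_rfl]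
    field_simp
  rw [w0] at hk
  by_cases h1 : m = b + 1
  · subst h1
    have e := h.w_prod 0
    rw [Finset.prod_range_succ, ← mul_assoc, ← h.top_eq, hq, zero_add, hk, hL] at e
    have : (2 + 2 * (W/A)) * (2 + 2 * (W/A)) = 2 * (W/A) := by
      field_simp
      field_simp at e
      linarith
    nlinarith
  · have e1 := h.ratio m 0 (b - m) (by omega)
    rw [zero_add, hk, hL' _ (by omega), hL' _ (by omega), div_self hA.ne'] at e1
    linarith

end Sys

section general
variable {P : Type*} [PartialOrder P] [Fintype P]

theorem extLab_toHat (aB wB : ℝ) (π : P → ℝ) (p : P) : extLab aB wB π (toHat p) = π p := rfl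

theorem hat_cases (r : Phat P) : r = ⊥ ∨ r = ((⊤ : WithTop P) : Phat P) ∨ ∃ p, r = toHat p := by
  induction r using WithBot.recBotCoe with
  | bot => exact Or.inl rfl
  | coe r =>
    induction r using WithTop.recTopCoe with
    | top => exact Or.inr (Or.inl rfl)
    | coe p => exact Or.inr (Or.inr ⟨p, rfl⟩)

theorem toHat_inj {p q : P} : toHat p = toHat q ↔ p = q := by
  unfold toHat
  rw [WithBot.coe_inj, WithTop.coe_inj]

theorem toHat_covBy {p q : P} : toHat p ⋖ toHat q ↔ p ⋖ q := by
  unfold toHat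
  rw [WithBot.coe_covBy_coe, WithTop.coe_covBy_coe]

theorem toHat_covBy_top {p : P} : toHat p ⋖ ((⊤ : WithTop P) : Phat P) ↔ IsMax p := by
  unfold toHat
  rw [WithBot.coe_covBy_coe, WithTop.coe_covBy_top]

theorem bot_covBy_toHat {p : P} : (⊥ : Phat P) ⋖ toHat p ↔ IsMin p := by
  unfold toHat
  rw [WithBot.bot_covBy_coe]
  constructor
  · intro h q hq
    exact WithTop.coe_le_coe.1 (h (WithTop.coe_le_coe.2 hq))
  · intro h q hq
    induction q using WithTop.recTopCoe with
    | top => exact le_top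
    | coe q => exact WithTop.coe_le_coe.2 (h (WithTop.coe_le_coe.1 hq))

theorem not_toHat_covBy_bot {p : P} : ¬ toHat p ⋖ (⊥ : Phat P) := fun h => not_lt_bot h.1

theorem not_top_covBy_toHat {p : P} : ¬ ((⊤ : WithTop P) : Phat P) ⋖ toHat p := by
  intro h
  have := h.1
  unfold toHat at this
  rw [WithBot.coe_lt_coe] at this
  exact not_top_lt this

theorem belowSum_congr (aB wB : ℝ) {π π' : P → ℝ} {p : P} (h : ∀ q, q < p → π q = π' q) :
    belowSum aB wB π p = belowSum aB wB π' p := by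
  unfold belowSum
  refine finsum_mem_congr rfl ?_
  intro r hr
  rcases hat_cases r with rfl | rfl | ⟨q, rfl⟩
  · rfl
  · rfl
  · exact h q (toHat_covBy.1 hr).1

theorem aboveInvSum_congr (aB wB : ℝ) {π π' : P → ℝ} {p : P} (h : ∀ q, p < q → π q = π' q) :
    aboveInvSum aB wB π p = aboveInvSum aB wB π' p := by
  unfold aboveInvSum
  refine finsum_mem_congr rfl ?_
  intro r hr
  rcases hat_cases r with rfl | rfl | ⟨q, rfl⟩
  · rfl
  · rfl
  · rw [extLab_toHat, extLab_toHat, h q (toHat_covBy.1 hr).1]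

theorem aboveInvSum_max (aB wB : ℝ) (π : P → ℝ) {p : P} (h : IsMax p) :
    aboveInvSum aB wB π p = wB⁻¹ := by
  have : {r : Phat P | toHat p ⋖ r} = {((⊤ : WithTop P) : Phat P)} := by
    ext r
    simp only [Set.mem_setOf_eq, Set.mem_singleton_iff]
    constructor
    · intro hr
      rcases hat_cases r with rfl | rfl | ⟨q, rfl⟩
      · exact absurd hr not_toHat_covBy_bot
      · rfl
      · exact absurd (toHat_covBy.1 hr).1 h.not_lt
    · rintro rfl
      exact toHat_covBy_top.2 h
  unfold aboveInvSum
  rw [this, finsum_mem_singleton]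
  rfl

theorem aboveInvSum_one (aB wB : ℝ) (π : P → ℝ) {p q : P} (h : ∀ r, p ⋖ r ↔ r = q) :
    aboveInvSum aB wB π p = (π q)⁻¹ := by
  have hq : p ⋖ q := (h q).2 rfl
  have : {r : Phat P | toHat p ⋖ r} = {toHat q} := by
    ext r
    simp only [Set.mem_setOf_eq, Set.mem_singleton_iff]
    constructor
    · intro hr
      rcases hat_cases r with rfl | rfl | ⟨s, rfl⟩
      · exact absurd hr not_toHat_covBy_bot
      · exact absurd hq.1 (toHat_covBy_top.1 hr).not_lt
      · rw [(h s).1 (toHat_covBy.1 hr)]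
    · rintro rfl
      exact toHat_covBy.2 hq
  unfold aboveInvSum
  rw [this, finsum_mem_singleton, extLab_toHat]

theorem belowSum_min (aB wB : ℝ) (π : P → ℝ) {p : P} (h : IsMin p) :
    belowSum aB wB π p = aB := by
  have : {r : Phat P | r ⋖ toHat p} = {⊥} := by
    ext r
    simp only [Set.mem_setOf_eq, Set.mem_singleton_iff]
    constructor
    · intro hr
      rcases hat_cases r with rfl | rfl | ⟨q, rfl⟩
      · rfl
      · exact absurd hr not_top_covBy_toHat
      · exact absurd (toHat_covBy.1 hr).1 h.not_lt
    · rintro rfl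
      exact bot_covBy_toHat.2 h
  unfold belowSum
  rw [this, finsum_mem_singleton]
  rfl

theorem below_set {p q q' : P} (h : ∀ r, r ⋖ p ↔ r = q ∨ r = q') :
    {r : Phat P | r ⋖ toHat p} = {toHat q, toHat q'} := by
  have hq : q ⋖ p := (h q).2 (Or.inl rfl)
  ext r
  simp only [Set.mem_setOf_eq, Set.mem_singleton_iff, Set.mem_insert_iff]
  constructor
  · intro hr
    rcases hat_cases r with rfl | rfl | ⟨s, rfl⟩
    · exact absurd hq.1 (bot_covBy_toHat.1 hr).not_lt
    · exact absurd hr not_top_covBy_toHat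
    · rw [toHat_inj, toHat_inj]
      exact (h s).1 (toHat_covBy.1 hr)
  · rintro (rfl | rfl)
    · exact toHat_covBy.2 hq
    · exact toHat_covBy.2 ((h q').2 (Or.inr rfl))

theorem belowSum_one (aB wB : ℝ) (π : P → ℝ) {p q : P} (h : ∀ r, r ⋖ p ↔ r = q) :
    belowSum aB wB π p = π q := by
  unfold belowSum
  rw [below_set (q := q) (q' := q) (by simpa using h), Set.pair_eq_singleton,
    finsum_mem_singleton, extLab_toHat]

theorem belowSum_two (aB wB : ℝ) (π : P → ℝ) {p q q' : P} (hne : q ≠ q')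
    (h : ∀ r, r ⋖ p ↔ r = q ∨ r = q') :
    belowSum aB wB π p = π q + π q' := by
  unfold belowSum
  rw [below_set h, finsum_mem_pair (fun hh => hne (toHat_inj.1 hh)), extLab_toHat, extLab_toHat]

theorem brho_list (aB wB : ℝ) (e : Fin (Fintype.card P) ≃ P) (he : IsLinearExtension e)
    (π : P → ℝ) (l : List (Fin (Fintype.card P))) (hl : l.Pairwise (· < ·)) :
    (∀ i, i ∉ l → (l.foldr (fun i g => btoggle aB wB (e i) ∘ g) id) π (e i) = π (e i)) ∧
    ∀ i ∈ l, (l.foldr (fun i g => btoggle aB wB (e i) ∘ g) id) π (e i) =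
      belowSum aB wB π (e i) / (π (e i) *
        aboveInvSum aB wB ((l.foldr (fun i g => btoggle aB wB (e i) ∘ g) id) π) (e i)) := by
  induction l with
  | nil => simp
  | cons i l ih =>
    rw [List.pairwise_cons] at hl
    obtain ⟨hi, hl⟩ := hl
    obtain ⟨ih1, ih2⟩ := ih hl
    simp only [List.foldr_cons, Function.comp_apply]
    generalize (l.foldr (fun i g => btoggle aB wB (e i) ∘ g) id) π = g at *
    have hil : i ∉ l := fun h => lt_irrefl _ (hi i h)
    have key : ∀ j, j ≠ i → btoggle aB wB (e i) g (e j) = g (e j) := by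
      intro j hj
      unfold btoggle
      rw [if_neg (fun h => hj (e.injective h))]
    have abv : ∀ j, i ≤ j → aboveInvSum aB wB (btoggle aB wB (e i) g) (e j)
        = aboveInvSum aB wB g (e j) := by
      intro j hj
      apply aboveInvSum_congr
      intro q hq
      obtain ⟨m, rfl⟩ := e.surjective q
      apply key
      rintro rfl
      have := he _ _ hq.le
      have : m = j := le_antisymm hj this
      subst this
      exact lt_irrefl _ hq
    constructor
    · intro j hj
      rw [List.mem_cons, not_or] at hj
      rw [key j hj.1, ih1 j hj.2]
    · intro j hj
      rw [List.mem_cons] at hj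
      rcases hj with rfl | hj
      · rw [abv j le_rfl]
        have h1 : btoggle aB wB (e j) g (e j) =
            belowSum aB wB g (e j) / (g (e j) * aboveInvSum aB wB g (e j)) := by
          unfold btoggle
          rw [if_pos rfl]
        rw [h1, ih1 j hil]
        congr 1
        apply belowSum_congr
        intro q hq
        obtain ⟨m, rfl⟩ := e.surjective q
        apply ih1
        intro hm
        exact absurd (hi m hm) (not_lt.2 (he _ _ hq.le))
      · rw [abv j (hi j hj).le, key j (hi j hj).ne', ih2 j hj]

theorem brho_eq (aB wB : ℝ) (e : Fin (Fintype.card P) ≃ P) (he : IsLinearExtension e)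
    (π : P → ℝ) (p : P) : brho aB wB e π p =
      belowSum aB wB π p / (π p * aboveInvSum aB wB (brho aB wB e π) p) := by
  obtain ⟨i, rfl⟩ := e.surjective p
  exact (brho_list aB wB e he π (List.finRange _) (List.pairwise_lt_finRange _)).2 i
    (List.mem_finRange i)

end general

section fence
variable {b : ℕ}

theorem fence_le {x y : FenceAA (b+1)} : x ≤ y ↔
    (x.idx ≤ y.idx ∧ y.idx ≤ b) ∨ (y.idx ≤ x.idx ∧ b ≤ y.idx) := Iff.rfl

theorem fence_lt {x y : FenceAA (b+1)} : x < y ↔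
    (x.idx < y.idx ∧ y.idx ≤ b) ∨ (y.idx < x.idx ∧ b ≤ y.idx) := by
  rw [lt_iff_le_not_ge, fence_le, fence_le]
  omega

theorem idx_lt (x : FenceAA (b+1)) : x.idx < 2 * b + 1 := by
  have := (show Fin (2 * (b+1) - 1) from x).isLt
  unfold FenceAA.idx
  omega

/-- the element with given index -/
def mk (b i : ℕ) (h : i < 2 * b + 1) : FenceAA (b+1) :=
  (⟨i, by omega⟩ : Fin (2 * (b+1) - 1))

theorem idx_mk (i : ℕ) (h : i < 2 * b + 1) : (mk b i h).idx = i := rfl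

theorem fence_covBy {x y : FenceAA (b+1)} : x ⋖ y ↔
    (y.idx = x.idx + 1 ∧ y.idx ≤ b) ∨ (x.idx = y.idx + 1 ∧ b ≤ y.idx) := by
  have hx := idx_lt x
  have hy := idx_lt y
  constructor
  · rintro ⟨h1, h2⟩
    rw [fence_lt] at h1
    rcases h1 with h1 | h1
    · have := @h2 (mk b (x.idx + 1) (by omega)) (by rw [fence_lt, idx_mk]; omega)
      rw [fence_lt, idx_mk] at this
      omega
    · have := @h2 (mk b (x.idx - 1) (by omega)) (by rw [fence_lt, idx_mk]; omega)
      rw [fence_lt, idx_mk] at this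
      omega
  · intro h
    refine ⟨by rw [fence_lt]; omega, ?_⟩
    intro z
    rw [fence_lt, fence_lt]
    omega

theorem fence_isMax {x : FenceAA (b+1)} (h : x.idx = b) : IsMax x := by
  intro y
  rw [fence_le, fence_le]
  omega

theorem fence_isMin {x : FenceAA (b+1)} (hb : 1 ≤ b) (h : x.idx = 0 ∨ x.idx = 2 * b) :
    IsMin x := by
  intro y
  have := idx_lt y
  rw [fence_le, fence_le]
  omega

theorem idx_eq_iff {x y : FenceAA (b+1)} : x = y ↔ x.idx = y.idx :=
  ⟨fun h => by rw [h], FenceAA.idx_inj⟩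

/-- left chain, positions `1, …, b+1` -/
def lft (b i : ℕ) : FenceAA (b+1) := mk b (min (i - 1) b) (by omega)
/-- right chain, positions `1, …, b+1` -/
def rgt (b i : ℕ) : FenceAA (b+1) := mk b (2 * b - min (i - 1) b) (by omega)

theorem idx_lft (i : ℕ) : (lft b i).idx = min (i - 1) b := rfl
theorem idx_rgt (i : ℕ) : (rgt b i).idx = 2 * b - min (i - 1) b := rfl

noncomputable def Lf (aB : ℝ) (b : ℕ) (π : FenceAA (b+1) → ℝ) (i : ℕ) : ℝ :=
  if i = 0 then aB else π (lft b i)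
noncomputable def Rf (aB : ℝ) (b : ℕ) (π : FenceAA (b+1) → ℝ) (i : ℕ) : ℝ :=
  if i = 0 then aB else π (rgt b i)

variable {aB wB : ℝ} {e : Fin (Fintype.card (FenceAA (b+1))) ≃ FenceAA (b+1)}

theorem brho_top (hb : 1 ≤ b) (he : IsLinearExtension e) (π : FenceAA (b+1) → ℝ) :
    brho aB wB e π (lft b (b+1)) =
      (Lf aB b π b + Rf aB b π b) / (π (lft b (b+1)) * wB⁻¹) := by
  rw [brho_eq aB wB e he, aboveInvSum_max _ _ _ (fence_isMax (by rw [idx_lft]; omega)),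
    belowSum_two (q := lft b b) (q' := rgt b b)]
  · simp [Lf, Rf, show b ≠ 0 by omega]
  · rw [Ne, idx_eq_iff, idx_lft, idx_rgt]
    omega
  · intro r
    have := idx_lt r
    rw [fence_covBy, idx_eq_iff, idx_eq_iff, idx_lft, idx_lft, idx_rgt]
    omega

theorem brho_lft (hb : 1 ≤ b) (he : IsLinearExtension e) (π : FenceAA (b+1) → ℝ) (i : ℕ)
    (hi : i < b) :
    brho aB wB e π (lft b (i+1)) =
      Lf aB b π i / (π (lft b (i+1)) * (brho aB wB e π (lft b (i+2)))⁻¹) := by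
  rw [brho_eq aB wB e he, aboveInvSum_one (q := lft b (i+2))]
  · congr 1
    by_cases h0 : i = 0
    · subst h0
      rw [belowSum_min _ _ _ (fence_isMin hb (by rw [idx_lft]; omega))]
      simp [Lf]
    · rw [belowSum_one (q := lft b i)]
      · simp [Lf, h0]
      · intro r
        have := idx_lt r
        rw [fence_covBy, idx_eq_iff, idx_lft, idx_lft]
        omega
  · intro r
    have := idx_lt r
    rw [fence_covBy, idx_eq_iff, idx_lft, idx_lft]
    omega

theorem brho_rgt (hb : 1 ≤ b) (he : IsLinearExtension e) (π : FenceAA (b+1) → ℝ) (i : ℕ)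
    (hi : i < b) :
    brho aB wB e π (rgt b (i+1)) =
      Rf aB b π i / (π (rgt b (i+1)) * (brho aB wB e π (rgt b (i+2)))⁻¹) := by
  rw [brho_eq aB wB e he, aboveInvSum_one (q := rgt b (i+2))]
  · congr 1
    by_cases h0 : i = 0
    · subst h0
      rw [belowSum_min _ _ _ (fence_isMin hb (by rw [idx_rgt]; omega))]
      simp [Rf]
    · rw [belowSum_one (q := rgt b i)]
      · simp [Rf, h0]
      · intro r
        have := idx_lt r
        rw [fence_covBy, idx_eq_iff, idx_rgt, idx_rgt]
        omega
  · intro r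
    have := idx_lt r
    rw [fence_covBy, idx_eq_iff, idx_rgt, idx_rgt]
    omega

theorem top_same : rgt b (b+1) = lft b (b+1) := by
  rw [idx_eq_iff, idx_lft, idx_rgt]
  omega

theorem lft_or_rgt (x : FenceAA (b+1)) :
    ∃ i, 1 ≤ i ∧ i ≤ b + 1 ∧ (x = lft b i ∨ x = rgt b i) := by
  have := idx_lt x
  by_cases h : x.idx ≤ b
  · refine ⟨x.idx + 1, by omega, by omega, Or.inl ?_⟩
    rw [idx_eq_iff, idx_lft]
    omega
  · refine ⟨2 * b - x.idx + 1, by omega, by omega, Or.inr ?_⟩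
    rw [idx_eq_iff, idx_rgt]
    omega

theorem Lf_pos (haB : 0 < aB) {π : FenceAA (b+1) → ℝ} (hπ : ∀ p, 0 < π p) (i : ℕ) :
    0 < Lf aB b π i := by
  unfold Lf
  split_ifs
  · exact haB
  · exact hπ _

theorem Rf_pos (haB : 0 < aB) {π : FenceAA (b+1) → ℝ} (hπ : ∀ p, 0 < π p) (i : ℕ) :
    0 < Rf aB b π i := by
  unfold Rf
  split_ifs
  · exact haB
  · exact hπ _

theorem brho_pos (hb : 1 ≤ b) (haB : 0 < aB) (hwB : 0 < wB) (he : IsLinearExtension e)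
    {π : FenceAA (b+1) → ℝ} (hπ : ∀ p, 0 < π p) (p : FenceAA (b+1)) :
    0 < brho aB wB e π p := by
  have ht : 0 < brho aB wB e π (lft b (b+1)) := by
    rw [brho_top hb he]
    have := Lf_pos haB hπ b
    have := Rf_pos haB hπ b
    have := hπ (lft b (b+1))
    positivity
  have key : ∀ j i, i + j = b → 0 < brho aB wB e π (lft b (i+1)) ∧
      0 < brho aB wB e π (rgt b (i+1)) := by
    intro j
    induction j with
    | zero =>
      intro i hi
      simp at hi
      subst hi
      rw [top_same]
      exact ⟨ht, ht⟩
    | succ j ih =>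
      intro i hi
      obtain ⟨h1, h2⟩ := ih (i+1) (by omega)
      rw [brho_lft hb he π i (by omega), brho_rgt hb he π i (by omega)]
      have := Lf_pos haB hπ i
      have := Rf_pos haB hπ i
      have := hπ (lft b (i+1))
      have := hπ (rgt b (i+1))
      constructor <;> positivity
  obtain ⟨i, h1, h2, rfl | rfl⟩ := lft_or_rgt p
  · have := (key (b + 1 - i) (i - 1) (by omega)).1
    rwa [show i - 1 + 1 = i by omega] at this
  · have := (key (b + 1 - i) (i - 1) (by omega)).2
    rwa [show i - 1 + 1 = i by omega] at this

theorem iter_pos (hb : 1 ≤ b) (haB : 0 < aB) (hwB : 0 < wB) (he : IsLinearExtension e)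
    {π : FenceAA (b+1) → ℝ} (hπ : ∀ p, 0 < π p) (n : ℕ) :
    ∀ p, 0 < (brho aB wB e)^[n] π p := by
  induction n with
  | zero => exact hπ
  | succ n ih =>
    rw [Function.iterate_succ_apply']
    exact brho_pos hb haB hwB he ih

theorem sys (hb : 1 ≤ b) (haB : 0 < aB) (hwB : 0 < wB) (he : IsLinearExtension e)
    {π : FenceAA (b+1) → ℝ} (hπ : ∀ p, 0 < π p) :
    Sys b aB wB (fun n => Lf aB b ((brho aB wB e)^[n] π))
      (fun n => Rf aB b ((brho aB wB e)^[n] π)) where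
  hW := hwB
  hA := haB
  Lpos n i := Lf_pos haB (iter_pos hb haB hwB he hπ n) i
  Rpos n i := Rf_pos haB (iter_pos hb haB hwB he hπ n) i
  L0 n := by simp [Lf]
  R0 n := by simp [Rf]
  top n := by simp [Lf, Rf, top_same]
  Lst n i hi := by
    have h1 := iter_pos hb haB hwB he hπ n (lft b (i+1))
    have h2 := iter_pos hb haB hwB he hπ (n+1) (lft b (i+2))
    have h3 := brho_lft (aB := aB) (wB := wB) hb he ((brho aB wB e)^[n] π) i hi
    rw [← Function.iterate_succ_apply' (brho aB wB e)] at h3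
    have e1 : ∀ m j, Lf aB b ((brho aB wB e)^[m] π) (j+1) = (brho aB wB e)^[m] π (lft b (j+1)) := by
      intro m j; simp [Lf]
    simp only [e1]
    rw [h3]
    field_simp
  Rst n i hi := by
    have h1 := iter_pos hb haB hwB he hπ n (rgt b (i+1))
    have h2 := iter_pos hb haB hwB he hπ (n+1) (rgt b (i+2))
    have h3 := brho_rgt (aB := aB) (wB := wB) hb he ((brho aB wB e)^[n] π) i hi
    rw [← Function.iterate_succ_apply' (brho aB wB e)] at h3
    have e1 : ∀ m j, Rf aB b ((brho aB wB e)^[m] π) (j+1) = (brho aB wB e)^[m] π (rgt b (j+1)) := by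
      intro m j; simp [Rf]
    simp only [e1]
    rw [h3]
    field_simp
  T n := by
    have h1 := iter_pos hb haB hwB he hπ n (lft b (b+1))
    have h3 := brho_top (aB := aB) (wB := wB) hb he ((brho aB wB e)^[n] π)
    rw [← Function.iterate_succ_apply' (brho aB wB e)] at h3
    have e1 : ∀ m j, Lf aB b ((brho aB wB e)^[m] π) (j+1) = (brho aB wB e)^[m] π (lft b (j+1)) := by
      intro m j; simp [Lf]
    simp only [e1]
    rw [h3]
    field_simp

theorem main_period (hb : 1 ≤ b) (haB : 0 < aB) (hwB : 0 < wB) (he : IsLinearExtension e)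
    {π : FenceAA (b+1) → ℝ} (hπ : ∀ p, 0 < π p) :
    (brho aB wB e)^[(b+1) * (b+2)] π = π := by
  have h := sys hb haB hwB he hπ
  funext p
  obtain ⟨i, h1, h2, rfl | rfl⟩ := lft_or_rgt p
  · have := h.L_period 0 i h2
    simpa [Lf, show i ≠ 0 by omega] using this
  · have := h.symm.L_period 0 i h2
    simpa [Rf, show i ≠ 0 by omega] using this

theorem main_wit (hb : 1 ≤ b) (haB : 0 < aB) (hwB : 0 < wB) (he : IsLinearExtension e)
    (k : ℕ) (hk : 0 < k) (hk' : k < (b+1) * (b+2)) :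
    ∃ π : FenceAA (b+1) → ℝ, (∀ p, 0 < π p) ∧ (brho aB wB e)^[k] π ≠ π := by
  by_cases h1 : (b+1) ∣ k
  · have h2 : ¬ (b+2) ∣ k := by
      intro h2
      have hc : Nat.Coprime (b+1) (b+2) := (Nat.coprime_self_add_right (m := b+1) (n := 1)).2 (Nat.coprime_one_right _)
      exact absurd (Nat.le_of_dvd hk (hc.mul_dvd_of_dvd_of_dvd h1 h2)) (by omega)
    let π : FenceAA (b+1) → ℝ := fun x => if x.idx = b then aB * (2 + 2 * (wB / aB)) else aB
    have hπ : ∀ p, 0 < π p := by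
      intro p
      simp only [π]
      split_ifs <;> positivity
    refine ⟨π, hπ, fun hp => h2 ?_⟩
    refine (sys hb haB hwB he hπ).wit2 ?_ ?_ ?_ k ?_
    · simp [Lf, π, idx_lft]
    · intro i hi
      by_cases h0 : i = 0
      · simp [Lf, h0]
      · simp only [Lf, h0, π, Function.iterate_zero, id, if_false]
        rw [if_neg (by rw [idx_lft]; omega)]
    · intro i hi
      by_cases h0 : i = 0
      · simp [Lf, Rf, h0]
      · simp only [Lf, Rf, h0, π, Function.iterate_zero, id, if_false]
        have hiff : (rgt b i).idx = b ↔ (lft b i).idx = b := by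
          rw [idx_lft, idx_rgt]
          omega
        by_cases hc : (lft b i).idx = b
        · rw [if_pos hc, if_pos (hiff.2 hc)]
        · rw [if_neg hc, if_neg (fun h => hc (hiff.1 h))]
    · simp only [Sys.w, hp, Function.iterate_zero, id]
  · let π : FenceAA (b+1) → ℝ := fun x => if x.idx = b - 1 then 2 * aB else aB
    have hπ : ∀ p, 0 < π p := by
      intro p
      simp only [π]
      split_ifs <;> positivity
    refine ⟨π, hπ, fun hp => h1 ?_⟩
    refine (sys hb haB hwB he hπ).wit1 hb ?_ ?_ ?_ k ?_
    · simp [Lf, π, idx_lft, show b ≠ 0 by omega]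
    · intro i hi hib
      by_cases h0 : i = 0
      · simp [Lf, h0]
      · simp only [Lf, h0, π, Function.iterate_zero, id, if_false]
        rw [if_neg (by rw [idx_lft]; omega)]
    · intro i hi
      by_cases h0 : i = 0
      · simp [Rf, h0]
      · simp only [Rf, h0, π, Function.iterate_zero, id, if_false]
        rw [if_neg (by rw [idx_rgt]; omega)]
    · simp only [Sys.q, Sys.w, hp, Function.iterate_zero, id]

end fence

/-- order of birational rowmotion on `F̆(a,a)`.
For any positive parameters `α^B, ω^B` and any linear extension defining `ρ^B`,
the order of `ρ^B` on the positive labelings of `F̆(a,a)` is exactly `a(a+1)`. -/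
theorem statement16 (a : ℕ) (ha : 2 ≤ a)
    (aB wB : ℝ) (haB : 0 < aB) (hwB : 0 < wB)
    (e : Fin (Fintype.card (FenceAA a)) ≃ FenceAA a) (he : IsLinearExtension e) :
    (∀ π : FenceAA a → ℝ, (∀ p, 0 < π p) →
      (brho aB wB e)^[a * (a + 1)] π = π)
    ∧ ∀ k : ℕ, 0 < k → k < a * (a + 1) →
        ∃ π : FenceAA a → ℝ, (∀ p, 0 < π p) ∧ (brho aB wB e)^[k] π ≠ π := by
  obtain ⟨b, rfl⟩ : ∃ b, a = b + 1 := ⟨a - 1, by omega⟩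
  have hb : 1 ≤ b := by omega
  exact ⟨fun π hπ => main_period hb haB hwB he hπ,
    fun k hk hk' => main_wit hb haB hwB he k hk hk'⟩

end Birational
end

section
/- Let P be a finite poset, let π : P → ℝ_{>0} be a labeling, and let p ∈ P. Then there exist constants C_1, C_2 ∈ ℝ_{>0} such that for all n ≥ 0, C_1 ≤ (ρ^B)^n(π)(p) ≤ C_2, where ρ^B is birational rowmotion. -/
open scoped Classical

namespace Birational

variable {P : Type*} [PartialOrder P] [Fintype P]

section Helpers

/-- the invariant energy on a finite type with relation `R`. -/
noncomputable def energy {Q : Type*} [Fintype Q] (R : Q → Q → Prop) (f : Q → ℝ) : ℝ :=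
  ∑ x, ∑ y, if R x y then f x / f y else 0

lemma energy_split {Q : Type*} [Fintype Q] (R : Q → Q → Prop) (p : Q) (hp : ¬ R p p)
    (f : Q → ℝ) :
    energy R f = (∑ x ∈ Finset.univ.erase p, ∑ y ∈ Finset.univ.erase p,
        if R x y then f x / f y else 0)
      + (∑ x ∈ Finset.univ.erase p, if R x p then f x else 0) / f p
      + f p * (∑ y ∈ Finset.univ.erase p, if R p y then (f y)⁻¹ else 0) := by
  have h1 : ∀ g : Q → ℝ, ∑ x, g x = g p + ∑ x ∈ Finset.univ.erase p, g x := fun g =>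
    (Finset.add_sum_erase _ g (Finset.mem_univ p)).symm
  unfold energy
  rw [h1]
  simp_rw [h1 (fun y => if R _ y then f _ / f y else 0)]
  rw [Finset.sum_add_distrib, if_neg hp, Finset.sum_div, Finset.mul_sum]
  have h2 : ∀ x, (if R x p then f x / f p else 0) = (if R x p then f x else 0) / f p := by
    intro x; split_ifs <;> simp
  have h3 : ∀ y, (if R p y then f p / f y else 0) = f p * (if R p y then (f y)⁻¹ else 0) := by
    intro x; split_ifs <;> simp [div_eq_mul_inv]
  simp_rw [h2, h3]
  ring

lemma sum_erase_eq {Q : Type*} [Fintype Q] (S : Q → Prop) (p : Q) (hp : ¬ S p) (f : Q → ℝ) :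
    (∑ x ∈ Finset.univ.erase p, if S x then f x else 0) = ∑ᶠ x ∈ {x | S x}, f x := by
  rw [finsum_mem_eq_sum_of_inter_support_eq (t := Finset.univ.filter S) f (by ext; simp),
    Finset.sum_filter]
  rw [← Finset.add_sum_erase _ _ (Finset.mem_univ p), if_neg hp, zero_add]

lemma energy_toggle {Q : Type*} [Fintype Q] (R : Q → Q → Prop) (p : Q) (hp : ¬ R p p)
    (f g : Q → ℝ) (hfg : ∀ x, x ≠ p → g x = f x)
    (h : (∑ᶠ x ∈ {x | R x p}, f x) / g p + g p * (∑ᶠ x ∈ {x | R p x}, (f x)⁻¹)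
      = (∑ᶠ x ∈ {x | R x p}, f x) / f p + f p * (∑ᶠ x ∈ {x | R p x}, (f x)⁻¹)) :
    energy R g = energy R f := by
  have e0 : ∀ x ∈ Finset.univ.erase p, g x = f x := fun x hx =>
    hfg x (Finset.ne_of_mem_erase hx)
  have e1 : (∑ x ∈ Finset.univ.erase p, ∑ y ∈ Finset.univ.erase p,
      if R x y then g x / g y else 0) = ∑ x ∈ Finset.univ.erase p, ∑ y ∈ Finset.univ.erase p,
      if R x y then f x / f y else 0 :=
    Finset.sum_congr rfl fun x hx => Finset.sum_congr rfl fun y hy => by rw [e0 x hx, e0 y hy]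
  have e2 : (∑ x ∈ Finset.univ.erase p, if R x p then g x else 0)
      = ∑ x ∈ Finset.univ.erase p, if R x p then f x else 0 :=
    Finset.sum_congr rfl fun x hx => by rw [e0 x hx]
  have e3 : (∑ x ∈ Finset.univ.erase p, if R p x then (g x)⁻¹ else 0)
      = ∑ x ∈ Finset.univ.erase p, if R p x then (f x)⁻¹ else 0 :=
    Finset.sum_congr rfl fun x hx => by rw [e0 x hx]
  rw [energy_split R p hp, energy_split R p hp, e1, e2, e3,
    sum_erase_eq (fun x => R x p) _ hp f,
    sum_erase_eq (fun x => R p x) _ hp (fun x => (f x)⁻¹), add_assoc, h, add_assoc]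

lemma extLab_pos (aB wB : ℝ) (haB : 0 < aB) (hwB : 0 < wB) (π : P → ℝ)
    (hπ : ∀ p, 0 < π p) (x : Phat P) : 0 < extLab aB wB π x := by
  induction x using WithBot.recBotCoe with
  | bot => exact haB
  | coe x =>
    induction x using WithTop.recTopCoe with
    | top => exact hwB
    | coe x => exact hπ x

lemma exists_below (x : Phat P) (hx : x ≠ ⊥) : ∃ r, r ⋖ x := by
  obtain ⟨r, -, hr⟩ := exists_le_covBy_of_lt (bot_lt_iff_ne_bot.2 hx)
  exact ⟨r, hr⟩

lemma exists_above (x : Phat P) (hx : x ≠ ⊤) : ∃ r, x ⋖ r := by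
  obtain ⟨r, hr, -⟩ := exists_covBy_le_of_lt (lt_top_iff_ne_top.2 hx)
  exact ⟨r, hr⟩

lemma toHat_ne_top (p : P) : toHat p ≠ ⊤ := by
  intro h
  exact WithTop.coe_ne_top (WithBot.coe_injective h)

lemma toHat_ne_bot (p : P) : toHat p ≠ ⊥ := WithBot.coe_ne_bot

lemma finsum_pos_aux {Q : Type*} [Fintype Q] (S : Q → Prop) (hS : ∃ x, S x) (f : Q → ℝ)
    (hf : ∀ x, 0 < f x) : 0 < ∑ᶠ x ∈ {x | S x}, f x := by
  rw [finsum_mem_eq_sum_of_inter_support_eq (t := Finset.univ.filter S) f (by ext; simp)]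
  obtain ⟨x, hx⟩ := hS
  exact Finset.sum_pos (fun i _ => hf i) ⟨x, by simp [hx]⟩

lemma extLab_btoggle_ne (aB wB : ℝ) (p : P) (π : P → ℝ) (x : Phat P) (hx : x ≠ toHat p) :
    extLab aB wB (btoggle aB wB p π) x = extLab aB wB π x := by
  induction x using WithBot.recBotCoe with
  | bot => rfl
  | coe x =>
    induction x using WithTop.recTopCoe with
    | top => rfl
    | coe x =>
      have : x ≠ p := fun h => hx (by rw [h]; rfl)
      change btoggle aB wB p π x = π x
      simp [btoggle, this]

/-- the energy is preserved by toggles, as is positivity. -/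
lemma btoggle_inv (aB wB : ℝ) (haB : 0 < aB) (hwB : 0 < wB) (p : P) (π : P → ℝ)
    (hπ : ∀ p, 0 < π p) :
    (∀ q, 0 < btoggle aB wB p π q) ∧
    energy (· ⋖ ·) (extLab aB wB (btoggle aB wB p π)) = energy (· ⋖ ·) (extLab aB wB π) := by
  have hpos := extLab_pos aB wB haB hwB π hπ
  have hB : 0 < belowSum aB wB π p :=
    finsum_pos_aux (fun r => r ⋖ toHat p) (exists_below _ (toHat_ne_bot p)) _ hpos
  have hA : 0 < aboveInvSum aB wB π p :=
    finsum_pos_aux (fun r => toHat p ⋖ r) (exists_above _ (toHat_ne_top p)) _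
      (fun x => inv_pos.2 (hpos x))
  have hp := hπ p
  constructor
  · intro q
    unfold btoggle
    split_ifs
    · positivity
    · exact hπ q
  have hirr : ¬ (toHat p ⋖ toHat p) := fun h => lt_irrefl _ h.lt
  refine energy_toggle (· ⋖ ·) (toHat p) hirr _ _
    (fun x hx => extLab_btoggle_ne aB wB p π x hx) ?_
  change _ = belowSum aB wB π p / _ + _ * aboveInvSum aB wB π p
  change belowSum aB wB π p / _ + _ * aboveInvSum aB wB π p = _
  have e4 : extLab aB wB (btoggle aB wB p π) (toHat p)
      = belowSum aB wB π p / (π p * aboveInvSum aB wB π p) := by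
    change btoggle aB wB p π p = _
    simp [btoggle]
  have e5 : extLab aB wB π (toHat p) = π p := rfl
  rw [e4, e5]
  field_simp
  ring

lemma brho_inv (aB wB : ℝ) (haB : 0 < aB) (hwB : 0 < wB) (e : Fin (Fintype.card P) ≃ P)
    (π : P → ℝ) (hπ : ∀ p, 0 < π p) :
    (∀ q, 0 < brho aB wB e π q) ∧
    energy (· ⋖ ·) (extLab aB wB (brho aB wB e π)) = energy (· ⋖ ·) (extLab aB wB π) := by
  unfold brho
  induction List.finRange (Fintype.card P) with
  | nil => exact ⟨hπ, rfl⟩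
  | cons i l ih =>
    have h := btoggle_inv aB wB haB hwB (e i) _ ih.1
    exact ⟨h.1, h.2.trans ih.2⟩

lemma brho_iter_inv (aB wB : ℝ) (haB : 0 < aB) (hwB : 0 < wB) (e : Fin (Fintype.card P) ≃ P)
    (π : P → ℝ) (hπ : ∀ p, 0 < π p) (n : ℕ) :
    (∀ q, 0 < (brho aB wB e)^[n] π q) ∧
    energy (· ⋖ ·) (extLab aB wB ((brho aB wB e)^[n] π)) = energy (· ⋖ ·) (extLab aB wB π) := by
  induction n with
  | zero => exact ⟨hπ, rfl⟩
  | succ n ih =>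
    rw [Function.iterate_succ_apply']
    have h := brho_inv aB wB haB hwB e _ ih.1
    exact ⟨h.1, h.2.trans ih.2⟩

lemma ratio_le_energy {Q : Type*} [Fintype Q] (R : Q → Q → Prop) (f : Q → ℝ)
    (hf : ∀ x, 0 < f x) (x y : Q) (h : R x y) : f x / f y ≤ energy R f := by
  have h0 : ∀ a b, 0 ≤ (if R a b then f a / f b else 0) := by
    intro a b
    split_ifs
    · exact (div_pos (hf a) (hf b)).le
    · exact le_rfl
  calc f x / f y = (if R x y then f x / f y else 0) := by rw [if_pos h]
    _ ≤ ∑ b, if R x b then f x / f b else 0 :=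
      Finset.single_le_sum (f := fun b => if R x b then f x / f b else 0)
        (fun b _ => h0 x b) (Finset.mem_univ y)
    _ ≤ _ := Finset.single_le_sum (f := fun a => ∑ b, if R a b then f a / f b else 0)
        (fun a _ => Finset.sum_nonneg fun b _ => h0 a b) (Finset.mem_univ x)

end Helpers

/-- Lemma `bounds on labels`.
For a finite poset `P`, positive parameters, a linear extension, a positive labeling `π`
and `p ∈ P`, there are constants `0 < C₁, C₂` with
`C₁ ≤ (ρ^B)^n(π)(p) ≤ C₂` for all `n ≥ 0`. -/
theorem statement17 {P : Type*} [PartialOrder P] [Fintype P]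
    (aB wB : ℝ) (haB : 0 < aB) (hwB : 0 < wB)
    (e : Fin (Fintype.card P) ≃ P) (he : IsLinearExtension e)
    (π : P → ℝ) (hπ : ∀ p, 0 < π p) (p : P) :
    ∃ C1 C2 : ℝ, 0 < C1 ∧ 0 < C2 ∧
      ∀ n : ℕ, C1 ≤ (brho aB wB e)^[n] π p ∧ (brho aB wB e)^[n] π p ≤ C2 := by
  set H := energy (· ⋖ ·) (extLab aB wB π) with hH
  set F : ℕ → Phat P → ℝ := fun n => extLab aB wB ((brho aB wB e)^[n] π) with hF
  have hinv := brho_iter_inv aB wB haB hwB e π hπ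
  have hpos : ∀ n x, 0 < F n x := fun n => extLab_pos aB wB haB hwB _ (hinv n).1
  have hrat : ∀ n (x y : Phat P), x ⋖ y → F n x ≤ H * F n y := by
    intro n x y hxy
    have h := ratio_le_energy (· ⋖ ·) (F n) (hpos n) x y hxy
    rw [(hinv n).2] at h
    exact (div_le_iff₀ (hpos n y)).1 h
  have hHpos : ∀ x y : Phat P, x ⋖ y → 0 < H := fun x y hxy =>
    pos_of_mul_pos_left ((hpos 0 x).trans_le (hrat 0 x y hxy)) (hpos 0 y).le
  have lower : ∀ x : Phat P, ∃ c : ℝ, 0 < c ∧ ∀ n, c ≤ F n x := by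
    intro x
    induction x using WellFoundedLT.induction with
    | ind x ih =>
      by_cases hx : x = ⊥
      · subst hx
        exact ⟨aB, haB, fun n => le_rfl⟩
      · obtain ⟨r, hr⟩ := exists_below x hx
        obtain ⟨c, hc, h⟩ := ih r hr.lt
        have := hHpos r x hr
        refine ⟨c / H, by positivity, fun n => ?_⟩
        rw [div_le_iff₀' this]
        exact (h n).trans (hrat n r x hr)
  have upper : ∀ x : Phat P, ∃ c : ℝ, 0 < c ∧ ∀ n, F n x ≤ c := by
    intro x
    induction x using WellFoundedGT.induction with
    | ind x ih =>
      by_cases hx : x = ⊤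
      · subst hx
        exact ⟨wB, hwB, fun n => le_rfl⟩
      · obtain ⟨r, hr⟩ := exists_above x hx
        obtain ⟨c, hc, h⟩ := ih r hr.lt
        have := hHpos x r hr
        refine ⟨H * c, by positivity, fun n => ?_⟩
        exact (hrat n x r hr).trans (mul_le_mul_of_nonneg_left (h n) this.le)
  obtain ⟨c1, h1, h1'⟩ := lower (toHat p)
  obtain ⟨c2, h2, h2'⟩ := upper (toHat p)
  exact ⟨c1, c2, h1, h2, fun n => ⟨h1' n, h2' n⟩⟩

end Birational
end
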